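/- For every d ∈ ℕ there exists a constant c = c(d) > 0 such that the following holds: if A ⊆ ℝ^d is a finite non-empty set with dim(A) = d, and for every choice of a_1, ..., a_c ∈ A we have |A + {a_1, ..., a_c}| ≤ (d + 1 + 1/16)|A|, then either |A| is bounded by a constant depending only on d, or there is a one-dimensional subspace l of ℝ^d and a set T ⊆ ℝ^d with |T| ≤ (d+1)^2 such that A ⊆ T + l. -/

import Mathlib

open Pointwise
open scoped Classical

theorem exists_saturated {G : Type*} [AddCommGroup G] [DecidableEq G] {A : Finset G}
    (B : Finset G) {ε C : ℝ} {N : ℕ} (hA : A.Nonempty) (hN : C < N * ε) :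
    ∃ Y ⊆ B, Y.card ≤ N ∧ (C * A.card < (A + Y).card ∨
      ∀ b ∈ B, (((A + {b}) \ (A + Y)).card : ℝ) ≤ ε * A.card) := by
  have hA' : (0 : ℝ) < A.card := by exact_mod_cast hA.card_pos
  have key : ∀ j : ℕ, ∃ Y ⊆ B, Y.card ≤ j ∧ ((j * ε) * A.card ≤ (A + Y).card ∨
      ∀ b ∈ B, (((A + {b}) \ (A + Y)).card : ℝ) ≤ ε * A.card) := by
    intro j
    induction j with
    | zero => exact ⟨∅, by simp, by simp, Or.inl (by simp)⟩
    | succ j ih =>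
      obtain ⟨Y, hYB, hY, h | h⟩ := ih
      · by_cases hs : ∀ b ∈ B, (((A + {b}) \ (A + Y)).card : ℝ) ≤ ε * A.card
        · exact ⟨Y, hYB, hY.trans (by omega), Or.inr hs⟩
        · push Not at hs
          obtain ⟨b, hb, hbY⟩ := hs
          refine ⟨insert b Y, Finset.insert_subset hb hYB,
            (Finset.card_insert_le _ _).trans (by omega), Or.inl ?_⟩
          have h1 : A + insert b Y = ((A + {b}) \ (A + Y)) ∪ (A + Y) := by
            rw [Finset.sdiff_union_self_eq_union, Finset.insert_eq, Finset.add_union]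
          rw [h1, Finset.card_union_of_disjoint Finset.sdiff_disjoint]
          push_cast
          nlinarith
      · exact ⟨Y, hYB, hY.trans (by omega), Or.inr h⟩
  obtain ⟨Y, hYB, hY, h | h⟩ := key N
  · exact ⟨Y, hYB, hY, Or.inl (by nlinarith)⟩
  · exact ⟨Y, hYB, hY, Or.inr h⟩

theorem card_add_card_image_le {G H : Type*} [AddCommGroup G] [AddCommGroup H] [DecidableEq G]
    [DecidableEq H] (q : G →+ H) {v : G} (hv : q v = 0) (hv' : ∀ n : ℕ, n ≠ 0 → n • v ≠ 0)
    {A S : Finset G} (hAS : A ⊆ S) (hAv : ∀ a ∈ A, a + v ∈ S) :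
    A.card + (S.image q).card ≤ S.card := by
  have hsub : S.image q ⊆ (S \ A).image q := by
    intro y hy
    obtain ⟨x, hx, rfl⟩ := Finset.mem_image.1 hy
    by_contra hcon
    have hall : ∀ n : ℕ, x + n • v ∈ A := by
      have hmem : ∀ z ∈ S, q z = q x → z ∈ A := by
        intro z hz hqz
        by_contra hzA
        exact hcon (Finset.mem_image.2 ⟨z, Finset.mem_sdiff.2 ⟨hz, hzA⟩, hqz⟩)
      intro n
      induction n with
      | zero => simpa using hmem x hx rfl
      | succ n ih =>
        refine hmem _ ?_ (by simp [hv])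
        rw [succ_nsmul, ← add_assoc]
        exact hAv _ ih
    have hinj : Function.Injective fun n : ℕ => x + n • v := by
      have hlt : ∀ m n : ℕ, m < n → x + m • v ≠ x + n • v := by
        intro m n hmn h
        have h1 : n • v = m • v + (n - m) • v := by rw [← add_nsmul]; congr 1; omega
        rw [h1, ← add_assoc] at h
        exact hv' (n - m) (by omega) (by simpa using h)
      intro m n h
      rcases lt_trichotomy m n with h1 | h1 | h1
      · exact absurd h (hlt _ _ h1)
      · exact h1
      · exact absurd h.symm (hlt _ _ h1)
    exact Set.infinite_of_injective_forall_mem hinj hall A.finite_toSet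
  have h1 := (Finset.card_le_card hsub).trans Finset.card_image_le
  have h2 := Finset.card_sdiff_add_card_eq_card hAS
  omega

theorem exists_linear_injOn {M : Type*} [AddCommGroup M] [Module ℝ M] (T : Finset M) :
    ∃ f : M →ₗ[ℝ] ℝ, Set.InjOn f T := by
  obtain ⟨f, hf⟩ := Module.exists_dual_forall_apply_ne_zero (K := ℝ)
    (fun p : {p : T × T // p.1 ≠ p.2} => (p.1.1 : M) - p.1.2)
    (fun p => by simpa [sub_eq_zero, Subtype.coe_inj] using p.2)
  refine ⟨f, fun x hx y hy hxy => ?_⟩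
  by_contra hne
  refine hf ⟨(⟨x, hx⟩, ⟨y, hy⟩), by simpa using hne⟩ ?_
  simp [hxy]

theorem exists_card_filter_notMem_le {G : Type*} [AddCommGroup G] [DecidableEq G]
    {A B S : Finset G} {ε : ℝ} (hA : A.Nonempty)
    (h : ∀ b ∈ B, (((A + {b}) \ S).card : ℝ) ≤ ε * A.card) :
    ∃ a ∈ A, ((B.filter fun b => a + b ∉ S).card : ℝ) ≤ ε * B.card := by
  by_contra! hcon
  have h1 : ∑ a ∈ A, (B.filter fun b => a + b ∉ S).card =
      ∑ b ∈ B, (A.filter fun a => a + b ∉ S).card := by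
    simp only [Finset.card_filter]
    exact Finset.sum_comm
  have h2 : ∀ b ∈ B, ((A.filter fun a => a + b ∉ S).card : ℝ) ≤ ε * A.card := by
    intro b hb
    refine le_trans ?_ (h b hb)
    rw [Nat.cast_le, ← Finset.card_image_of_injective _ (add_left_injective b)]
    refine Finset.card_le_card fun x hx => ?_
    obtain ⟨a, ha, rfl⟩ := Finset.mem_image.1 hx
    rw [Finset.mem_filter] at ha
    exact Finset.mem_sdiff.2 ⟨Finset.add_mem_add ha.1 (Finset.mem_singleton_self b), ha.2⟩
  have h3 : ∑ a ∈ A, ε * (B.card : ℝ) < ∑ a ∈ A, ((B.filter fun b => a + b ∉ S).card : ℝ) :=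
    Finset.sum_lt_sum_of_nonempty hA hcon
  have h4 : ∑ b ∈ B, ((A.filter fun a => a + b ∉ S).card : ℝ) ≤ ∑ b ∈ B, ε * (A.card : ℝ) :=
    Finset.sum_le_sum h2
  have h5 : ∑ a ∈ A, ((B.filter fun b => a + b ∉ S).card : ℝ) =
      ∑ b ∈ B, ((A.filter fun a => a + b ∉ S).card : ℝ) := by exact_mod_cast h1
  simp only [Finset.sum_const, nsmul_eq_mul] at h3 h4
  nlinarith

/-- A bounded subset `Y` of `B` nearly attains the trivial bound `|A + B| ≥ |A| + |B|`. -/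
theorem exists_card_add_ge {M : Type*} [AddCommGroup M] [Module ℝ M] [DecidableEq M]
    {ε r : ℝ} (hε : 0 < ε) :
    ∃ c : ℕ, ∀ A B : Finset M, A.Nonempty → (B.card : ℝ) ≤ r * A.card → 2 ≤ B.card →
      1 ≤ ε * B.card →
      ∃ Y ⊆ B, Y.card ≤ c ∧ (A.card : ℝ) + (1 - 2 * ε) * B.card ≤ (A + Y).card := by
  obtain ⟨N, hN⟩ := exists_nat_gt ((1 + r) / ε)
  rw [div_lt_iff₀ hε] at hN
  refine ⟨N + 2, fun A B hA hr hB hB' => ?_⟩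
  obtain ⟨Y, hYB, hYN, h | h⟩ := exists_saturated B (ε := ε) hA hN
  · exact ⟨Y, hYB, by omega, by nlinarith⟩
  obtain ⟨f, hf⟩ := exists_linear_injOn B
  have hBne : B.Nonempty := Finset.card_pos.1 (by omega)
  obtain ⟨b₀, hb₀, hmin⟩ := B.exists_min_image f hBne
  obtain ⟨b₁, hb₁, hmax⟩ := B.exists_max_image f hBne
  have hlt : f b₀ < f b₁ := by
    obtain ⟨x, hx, y, hy, hxy⟩ := Finset.one_lt_card.1 (by omega : 1 < B.card)
    have h1 := hmin x hx
    have h2 := hmin y hy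
    have h3 := hmax x hx
    have h4 := hmax y hy
    rcases lt_or_gt_of_ne (fun h => hxy (hf hx hy h)) with h5 | h5 <;> linarith
  set v := b₁ - b₀ with hv
  have hfv : 0 < f v := by simp [hv, hlt]
  set q := QuotientAddGroup.mk' (AddSubgroup.zmultiples v) with hq
  set Y' := insert b₀ (insert b₁ Y) with hY'
  set S := A + Y' with hS
  have hAS : A + Y ⊆ S := Finset.add_subset_add_left fun y hy => by simp [hY', hy]
  obtain ⟨a, ha, hab⟩ := exists_card_filter_notMem_le (S := S) (B := B) hA fun b hb =>
    le_trans (by exact_mod_cast Finset.card_le_card (Finset.sdiff_subset_sdiff le_rfl hAS)) (h b hb)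
  have hstep : (A + {b₀}).card + (S.image q).card ≤ S.card := by
    refine card_add_card_image_le q (v := v) ?_ ?_ ?_ ?_
    · simp [hq]
    · intro n hn h0
      have : f (n • v) = 0 := by rw [h0, map_zero]
      simp only [map_nsmul, nsmul_eq_mul, mul_eq_zero, Nat.cast_eq_zero] at this
      rcases this with h | h
      · exact hn h
      · exact hfv.ne' h
    · exact Finset.add_subset_add_left (by simp [hY'])
    · intro x hx
      obtain ⟨y, hy, z, hz, rfl⟩ := Finset.mem_add.1 hx
      rw [Finset.mem_singleton] at hz
      rw [hz, hv, show y + b₀ + (b₁ - b₀) = y + b₁ by abel]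
      exact Finset.add_mem_add hy (by simp [hY'])
  have hqS : (B.filter fun b => a + b ∈ S).card ≤ (S.image q).card + 1 := by
    have h1 : ((B.filter fun b => a + b ∈ S).erase b₁).card ≤ (S.image q).card := by
      refine Finset.card_le_card_of_injOn (fun b => q (a + b)) ?_ ?_
      · intro b hb
        simp only [Finset.coe_erase, Finset.coe_filter, Set.mem_sdiff, Set.mem_ofPred_eq] at hb
        exact Finset.mem_coe.2 (Finset.mem_image_of_mem _ hb.1.2)
      · intro x hx y hy hxy
        simp only [Finset.coe_erase, Finset.coe_filter, Set.mem_sdiff, Set.mem_ofPred_eq,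
          Set.mem_singleton_iff] at hx hy
        simp only [map_add, add_right_inj] at hxy
        rw [hq, QuotientAddGroup.mk'_apply, QuotientAddGroup.mk'_apply, QuotientAddGroup.eq,
          AddSubgroup.mem_zmultiples_iff] at hxy
        obtain ⟨n, hn⟩ := hxy
        have hn' : (n : ℝ) * f v = f y - f x := by
          have := congrArg f hn
          simp only [map_zsmul, zsmul_eq_mul, map_add, map_neg] at this
          linarith
        have hfv' : f v = f b₁ - f b₀ := by simp [hv]
        have hx1 : f x < f b₁ := lt_of_le_of_ne (hmax x hx.1.1) fun h => hx.2 (hf hx.1.1 hb₁ h)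
        have hy1 : f y < f b₁ := lt_of_le_of_ne (hmax y hy.1.1) fun h => hy.2 (hf hy.1.1 hb₁ h)
        have hx0 := hmin x hx.1.1
        have hy0 := hmin y hy.1.1
        have hn1 : (n : ℝ) < 1 := by nlinarith
        have hn2 : (-1 : ℝ) < n := by nlinarith
        have hn3 : n < 1 := by exact_mod_cast hn1
        have hn4 : -1 < n := by exact_mod_cast hn2
        have hn0 : n = 0 := by omega
        refine hf hx.1.1 hy.1.1 ?_
        rw [hn0] at hn'
        simp at hn'
        linarith
    have h2 := Finset.pred_card_le_card_erase (s := B.filter fun b => a + b ∈ S) (a := b₁)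
    omega
  have hsplit := Finset.card_filter_add_card_filter_not (s := B) (fun b => a + b ∈ S)
  refine ⟨Y', ?_, ?_, ?_⟩
  · intro y hy
    simp only [hY', Finset.mem_insert] at hy
    rcases hy with rfl | rfl | hy
    exacts [hb₀, hb₁, hYB hy]
  · have h1 : Y'.card ≤ _ := Finset.card_insert_le b₀ (insert b₁ Y)
    have h2 := Finset.card_insert_le b₁ Y
    omega
  · rw [Finset.card_add_singleton] at hstep
    have e1 : ((A.card : ℝ) + (S.image q).card) ≤ S.card := by exact_mod_cast hstep
    have e2 : (((B.filter fun b => a + b ∈ S).card : ℝ)) ≤ (S.image q).card + 1 := by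
      exact_mod_cast hqS
    have e3 : (((B.filter fun b => a + b ∈ S).card : ℝ)) +
      ((B.filter fun b => a + b ∉ S).card : ℝ) = B.card := by exact_mod_cast hsplit
    linarith

theorem finset_induction_of_injOn {M : Type*} [DecidableEq M] {f : M → ℝ} {T : Finset M}
    (hf : Set.InjOn f T) {p : Finset M → Prop} (empty : p ∅)
    (step : ∀ v T', insert v T' ⊆ T → (∀ t ∈ T', f v < f t) → p T' → p (insert v T')) : p T := by
  suffices h : ∀ T' ⊆ T, p T' from h T le_rfl
  intro T'
  refine Finset.induction_on_min_value (motive := fun s => s ⊆ T → p s) f T' (fun _ => empty) ?_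
  intro v s hv hmin ih hs
  refine step v s hs (fun t ht => lt_of_le_of_ne (hmin t ht) fun h => hv ?_)
    (ih ((Finset.subset_insert _ _).trans hs))
  rwa [hf (hs (Finset.mem_insert_self _ _)) (hs (Finset.mem_insert_of_mem ht)) h]

/-- The dimension of the affine span of a finite set. -/
noncomputable abbrev affineRank {M : Type*} [AddCommGroup M] [Module ℝ M] (T : Finset M) : ℕ :=
  Module.finrank ℝ (vectorSpan ℝ (T : Set M))

theorem exists_fresh {M : Type*} [AddCommGroup M] [Module ℝ M] [FiniteDimensional ℝ M]
    [DecidableEq M] (f : M →ₗ[ℝ] ℝ) {v : M} {T : Finset M} (hv : ∀ t ∈ T, f v < f t) :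
    ∃ I ⊆ T, affineRank (insert v T) ≤ I.card ∧ (∀ t ∈ I, v + t ∉ T + T) ∧
      (∀ u ∈ T, (∀ t ∈ T, f u ≤ f t) → u ∈ I) ∧
      (affineRank (insert v T) = affineRank T ∨
        affineRank (insert v T) = affineRank T + 1 ∧ I = T ∧ ∀ s ∈ T, ∀ t ∈ T, ∀ u ∈ T,
          v + s ≠ t + u) := by
  refine ⟨T.filter fun t => v + t ∉ T + T, Finset.filter_subset _ _, ?_,
    fun t ht => (Finset.mem_filter.1 ht).2, ?_, ?_⟩
  · set I := T.filter fun t => v + t ∉ T + T with hI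
    have hspan : ∀ t ∈ T, t - v ∈ Submodule.span ℝ ((I.image (· - v) : Finset M) : Set M) := by
      by_contra! hcon
      obtain ⟨t, ht, htm, hmin⟩ : ∃ t ∈ T,
          t - v ∉ Submodule.span ℝ ((I.image (· - v) : Finset M) : Set M) ∧
          ∀ s ∈ T, f s < f t → s - v ∈ Submodule.span ℝ ((I.image (· - v) : Finset M) : Set M) := by
        obtain ⟨t₀, ht₀, ht₀'⟩ := hcon
        obtain ⟨t, ht, hmin⟩ := (T.filter fun t => t - v ∉ Submodule.span ℝ
          ((I.image (· - v) : Finset M) : Set M)).exists_min_image f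
          ⟨t₀, Finset.mem_filter.2 ⟨ht₀, ht₀'⟩⟩
        rw [Finset.mem_filter] at ht
        refine ⟨t, ht.1, ht.2, fun s hs hst => ?_⟩
        by_contra hs'
        exact absurd (hmin s (Finset.mem_filter.2 ⟨hs, hs'⟩)) (not_le.2 hst)
      by_cases htI : t ∈ I
      · exact htm (Submodule.subset_span (Finset.mem_coe.2 (Finset.mem_image_of_mem _ htI)))
      · have : v + t ∈ T + T := by
          by_contra h
          exact htI (Finset.mem_filter.2 ⟨ht, h⟩)
        obtain ⟨a, ha, b, hb, hab⟩ := Finset.mem_add.1 this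
        have hfab : f a + f b = f v + f t := by rw [← map_add, hab, map_add]
        have h1 := hv a ha
        have h2 := hv b hb
        have h3 : t - v = (a - v) + (b - v) := by
          rw [show (a - v) + (b - v) = (a + b) - v - v by abel, hab]; abel
        rw [h3] at htm
        exact htm (Submodule.add_mem _ (hmin a ha (by linarith)) (hmin b hb (by linarith)))
    have hle : vectorSpan ℝ ((insert v T : Finset M) : Set M) ≤
        Submodule.span ℝ ((I.image (· - v) : Finset M) : Set M) := by
      rw [vectorSpan_eq_span_vsub_set_right ℝ (p := v) (by simp), Submodule.span_le]
      rintro _ ⟨t, ht, rfl⟩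
      simp only [Finset.coe_insert, Set.mem_insert_iff, Finset.mem_coe] at ht
      rcases ht with rfl | ht
      · simp
      · exact hspan t ht
    exact (Submodule.finrank_mono hle).trans
      ((finrank_span_finset_le_card _).trans Finset.card_image_le)
  · intro u hu hmin
    refine Finset.mem_filter.2 ⟨hu, fun h => ?_⟩
    obtain ⟨a, ha, b, hb, hab⟩ := Finset.mem_add.1 h
    have hfab : f a + f b = f v + f u := by rw [← map_add, hab, map_add]
    have h1 := hmin a ha
    have h2 := hmin b hb
    have h3 := hv u hu
    linarith
  · by_cases hva : v ∈ affineSpan ℝ (T : Set M)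
    · left
      rw [affineRank, Finset.coe_insert, vectorSpan_insert_eq_vectorSpan hva]
    · have hne : ∀ s ∈ T, ∀ t ∈ T, ∀ u ∈ T, v + s ≠ t + u := by
        intro s hs t ht u hu h
        apply hva
        have h1 : v = (t - s) +ᵥ u := by
          rw [vadd_eq_add, show t - s + u = t + u - s by abel, ← h]; abel
        rw [h1]
        exact AffineSubspace.vadd_mem_of_mem_direction
          (by rw [direction_affineSpan]; exact vsub_mem_vectorSpan ℝ ht hs)
          (subset_affineSpan ℝ _ hu)
      have hfil : (T.filter fun t => v + t ∉ T + T) = T := by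
        refine Finset.filter_true_of_mem fun s hs h => ?_
        obtain ⟨a, ha, b, hb, hab⟩ := Finset.mem_add.1 h
        exact hne s hs a ha b hb hab.symm
      have hle : affineRank (insert v T) ≤ affineRank T + 1 := by
        rw [affineRank, Finset.coe_insert]
        exact finrank_vectorSpan_insert_le_set ℝ _ v
      have hge : affineRank T ≤ affineRank (insert v T) :=
        Submodule.finrank_mono (vectorSpan_mono ℝ (by simp))
      rcases hle.lt_or_eq with h | h
      · left; omega
      · right; exact ⟨h, hfil, hne⟩

theorem sum_add_insert_ge {M : Type*} [AddCommGroup M] [Module ℝ M]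
    [DecidableEq M] {f : M →ₗ[ℝ] ℝ} {v : M} {T I : Finset M} (hv : ∀ t ∈ T, f v < f t)
    (hIT : I ⊆ T) (hI : ∀ t ∈ I, v + t ∉ T + T) {g : M → ℝ} (hg : ∀ x, 0 ≤ g x) :
    ∑ x ∈ T + T, g x + ∑ t ∈ I, g (v + t) + g (v + v) ≤ ∑ x ∈ insert v T + insert v T, g x := by
  have hvT : v ∉ T := fun h => lt_irrefl _ (hv v h)
  have h1 : ∑ t ∈ I, g (v + t) = ∑ x ∈ I.image (v + ·), g x :=
    (Finset.sum_image fun x _ y _ h => add_left_cancel h).symm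
  have hd1 : Disjoint (T + T) (I.image (v + ·)) := by
    rw [Finset.disjoint_right]
    intro x hx
    obtain ⟨t, ht, rfl⟩ := Finset.mem_image.1 hx
    exact hI t ht
  have hd2 : v + v ∉ (T + T) ∪ I.image (v + ·) := by
    rw [Finset.mem_union, not_or]
    constructor
    · intro h
      obtain ⟨a, ha, b, hb, hab⟩ := Finset.mem_add.1 h
      have hfab : f a + f b = f v + f v := by rw [← map_add, hab, map_add]
      have h1 := hv a ha
      have h2 := hv b hb
      linarith
    · intro h
      obtain ⟨t, ht, hvt⟩ := Finset.mem_image.1 h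
      exact hvT (add_left_cancel hvt ▸ hIT ht)
  rw [h1, ← Finset.sum_union hd1, add_comm, ← Finset.sum_insert hd2]
  refine Finset.sum_le_sum_of_subset_of_nonneg ?_ fun _ _ _ => hg _
  intro x hx
  simp only [Finset.mem_insert, Finset.mem_union, Finset.mem_image] at hx
  rcases hx with rfl | hx | ⟨t, ht, rfl⟩
  · exact Finset.add_mem_add (Finset.mem_insert_self _ _) (Finset.mem_insert_self _ _)
  · exact Finset.add_subset_add (Finset.subset_insert _ _) (Finset.subset_insert _ _) hx
  · exact Finset.add_mem_add (Finset.mem_insert_self _ _) (Finset.mem_insert_of_mem (hIT ht))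

section Weighted

variable {M : Type*} [AddCommGroup M] [Module ℝ M] [FiniteDimensional ℝ M] [DecidableEq M]

theorem sum_diag_add_rank_mul_le {T : Finset M} {w D g : M → ℝ} (hw : ∀ t ∈ T, 0 ≤ w t)
    (hg : ∀ x, 0 ≤ g x) (hD : ∀ t ∈ T, D t ≤ g (t + t))
    (hwg : ∀ s ∈ T, ∀ t ∈ T, w s + w t ≤ g (s + t)) :
    ∑ t ∈ T, D t + affineRank T * ∑ t ∈ T, w t ≤ ∑ x ∈ T + T, g x := by
  obtain ⟨f, hf⟩ := exists_linear_injOn T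
  refine finset_induction_of_injOn hf
    (p := fun T => ∑ t ∈ T, D t + affineRank T * ∑ t ∈ T, w t ≤ ∑ x ∈ T + T, g x)
    (by simp) fun v T' hsub hv ih => ?_
  obtain ⟨I, hIT, hIcard, hI, -, hdim⟩ := exists_fresh f hv
  have hvT : v ∉ T' := fun h => lt_irrefl _ (hv v h)
  have hsum := sum_add_insert_ge hv hIT hI hg
  have hvm := hsub (Finset.mem_insert_self v T')
  have h1 : ∑ t ∈ I, (w v + w t) ≤ ∑ t ∈ I, g (v + t) :=
    Finset.sum_le_sum fun t ht => hwg v hvm t (hsub (Finset.mem_insert_of_mem (hIT ht)))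
  rw [Finset.sum_add_distrib, Finset.sum_const, nsmul_eq_mul] at h1
  have h2 : (affineRank (insert v T') : ℝ) * w v ≤ I.card * w v :=
    mul_le_mul_of_nonneg_right (by exact_mod_cast hIcard) (hw v hvm)
  have h3 := hD v hvm
  rw [Finset.sum_insert hvT, Finset.sum_insert hvT]
  rcases hdim with hdim | ⟨hdim, rfl, -⟩
  · have h4 : 0 ≤ ∑ t ∈ I, w t :=
      Finset.sum_nonneg fun t ht => hw t (hsub (Finset.mem_insert_of_mem (hIT ht)))
    rw [← hdim] at ih
    linarith
  · rw [hdim] at h2 ⊢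
    push_cast at h2 ⊢
    linarith

theorem rank_add_three_mul_le {T : Finset M} {w g : M → ℝ} {w₀ : ℝ} (hT : T.Nonempty)
    (hw : ∀ t ∈ T, 0 ≤ w t) (hw₀ : ∀ t ∈ T, w t ≤ w₀) (hg : ∀ x, 0 ≤ g x)
    (hwg : ∀ s ∈ T, ∀ t ∈ T, w s + w t ≤ g (s + t)) :
    (affineRank T + 3) * ∑ t ∈ T, w t ≤ ∑ x ∈ T + T, g x + (affineRank T + 1) * w₀ := by
  obtain ⟨f, hf⟩ := exists_linear_injOn T
  have key : ∀ u ∈ T, (∀ t ∈ T, f u ≤ f t) →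
      (affineRank T + 3) * ∑ t ∈ T, w t ≤ ∑ x ∈ T + T, g x + w u + affineRank T * w₀ := by
    refine finset_induction_of_injOn hf
      (p := fun T => ∀ u ∈ T, (∀ t ∈ T, f u ≤ f t) →
        (affineRank T + 3) * ∑ t ∈ T, w t ≤ ∑ x ∈ T + T, g x + w u + affineRank T * w₀)
      (by simp) fun v T' hsub hv ih u hu hmin => ?_
    have hvT : v ∉ T' := fun h => lt_irrefl _ (hv v h)
    have hvm := hsub (Finset.mem_insert_self v T')
    obtain rfl : u = v := by
      rcases Finset.mem_insert.1 hu with h | h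
      · exact h
      · exact absurd (hmin v (Finset.mem_insert_self _ _)) (not_le.2 (hv u h))
    obtain ⟨I, hIT, hIcard, hI, hfirst, hdim⟩ := exists_fresh f hv
    have hsum := sum_add_insert_ge hv hIT hI hg
    have hmemI : ∀ t ∈ I, t ∈ T := fun t ht => hsub (Finset.mem_insert_of_mem (hIT ht))
    rcases T'.eq_empty_or_nonempty with rfl | hne
    · have h1 : affineRank (insert u (∅ : Finset M)) = 0 := by
        rw [affineRank, insert_empty_eq, Finset.coe_singleton, vectorSpan_singleton, finrank_bot]
      rw [h1]
      have h2 := hwg u hvm u hvm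
      simp
      linarith
    · obtain ⟨u', hu', hmin'⟩ := T'.exists_min_image f hne
      have ih' := ih u' hu' hmin'
      have h1 : ∑ t ∈ I, (w u + w t) ≤ ∑ t ∈ I, g (u + t) :=
        Finset.sum_le_sum fun t ht => hwg u hvm t (hmemI t ht)
      rw [Finset.sum_add_distrib, Finset.sum_const, nsmul_eq_mul] at h1
      have h2 : (affineRank (insert u T') : ℝ) * w u ≤ I.card * w u :=
        mul_le_mul_of_nonneg_right (by exact_mod_cast hIcard) (hw u hvm)
      have h3 := hwg u hvm u hvm
      have h4 : w u' ≤ ∑ t ∈ I, w t :=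
        Finset.single_le_sum (fun t ht => hw t (hmemI t ht)) (hfirst u' hu' hmin')
      have h5 := hw₀ u' (hsub (Finset.mem_insert_of_mem hu'))
      rw [Finset.sum_insert hvT]
      rcases hdim with hdim | ⟨hdim, rfl, -⟩
      · rw [← hdim] at ih'
        linarith
      · rw [hdim] at h2 ⊢
        push_cast at h2 ⊢
        linarith
  obtain ⟨u, hu, hmin⟩ := T.exists_min_image f hT
  have h1 := key u hu hmin
  have h2 := hw₀ u hu
  linarith

theorem card_add_rank_mul_le (T : Finset M) : ∀ P ⊆ T, P.Nonempty →
    (T.card : ℝ) + affineRank T * P.card ≤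
      (P + T).card + (affineRank T * (affineRank T + 1) / 2 : ℝ) := by
  obtain ⟨f, hf⟩ := exists_linear_injOn T
  refine finset_induction_of_injOn hf (p := fun T => ∀ P ⊆ T, P.Nonempty →
    (T.card : ℝ) + affineRank T * P.card ≤
      (P + T).card + (affineRank T * (affineRank T + 1) / 2 : ℝ)) ?_
    fun v T' hsub hv ih P hPT hP => ?_
  · intro P hP hP'
    exact absurd (Finset.subset_empty.1 hP) hP'.ne_empty
  have hvT : v ∉ T' := fun h => lt_irrefl _ (hv v h)
  obtain ⟨I, hIT, hIcard, hI, -, hdim⟩ := exists_fresh f hv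
  rw [Finset.card_insert_of_notMem hvT]
  by_cases hvP : v ∈ P
  · obtain ⟨P', hvP', rfl⟩ : ∃ P', v ∉ P' ∧ insert v P' = P :=
      ⟨P.erase v, Finset.notMem_erase _ _, Finset.insert_erase hvP⟩
    have hP'T : P' ⊆ T' := by
      intro x hx
      rcases Finset.mem_insert.1 (hPT (Finset.mem_insert_of_mem hx)) with rfl | h
      · exact absurd hx hvP'
      · exact h
    rcases P'.eq_empty_or_nonempty with rfl | hne
    · have h1 : (insert v ∅ + insert v T').card = T'.card + 1 := by
        rw [insert_empty_eq, Finset.card_singleton_add, Finset.card_insert_of_notMem hvT]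
      rw [h1]
      simp only [insert_empty_eq, Finset.card_singleton]
      push_cast
      rcases Nat.eq_zero_or_pos (affineRank (insert v T')) with h0 | h0
      · rw [h0]; simp
      · have : (1 : ℝ) ≤ affineRank (insert v T') := by exact_mod_cast h0
        nlinarith
    · have ih' := ih P' hP'T hne
      have hcard : (P' + T').card + I.card + 1 ≤ (insert v P' + insert v T').card := by
        have hd1 : Disjoint (P' + T') (I.image (v + ·)) := by
          rw [Finset.disjoint_right]
          intro x hx
          obtain ⟨t, ht, rfl⟩ := Finset.mem_image.1 hx
          exact fun h => hI t ht (Finset.add_subset_add_right hP'T h)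
        have hd2 : v + v ∉ (P' + T') ∪ I.image (v + ·) := by
          rw [Finset.mem_union, not_or]
          constructor
          · intro h
            obtain ⟨a, ha, b, hb, hab⟩ := Finset.mem_add.1 h
            have hfab : f a + f b = f v + f v := by rw [← map_add, hab, map_add]
            have h1 := hv a (hP'T ha)
            have h2 := hv b hb
            linarith
          · intro h
            obtain ⟨t, ht, hvt⟩ := Finset.mem_image.1 h
            exact hvT (add_left_cancel hvt ▸ hIT ht)
        have h1 : (I.image (v + ·)).card = I.card :=
          Finset.card_image_of_injective _ (add_right_injective v)
        rw [← h1, ← Finset.card_union_of_disjoint hd1, ← Finset.card_insert_of_notMem hd2]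
        refine Finset.card_le_card fun x hx => ?_
        simp only [Finset.mem_insert, Finset.mem_union, Finset.mem_image] at hx
        rcases hx with rfl | hx | ⟨t, ht, rfl⟩
        · exact Finset.add_mem_add (Finset.mem_insert_self _ _) (Finset.mem_insert_self _ _)
        · exact Finset.add_subset_add (Finset.subset_insert _ _) (Finset.subset_insert _ _) hx
        · exact Finset.add_mem_add (Finset.mem_insert_self _ _)
            (Finset.mem_insert_of_mem (hIT ht))
      have hcard' : ((P' + T').card : ℝ) + I.card + 1 ≤ (insert v P' + insert v T').card := by
        exact_mod_cast hcard
      have hIcard' : (affineRank (insert v T') : ℝ) ≤ I.card := by exact_mod_cast hIcard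
      rw [Finset.card_insert_of_notMem hvP']
      rcases hdim with hdim | ⟨hdim, rfl, -⟩
      · rw [← hdim] at ih'
        push_cast
        linarith
      · have h1 : (P'.card : ℝ) ≤ I.card := by exact_mod_cast Finset.card_le_card hP'T
        rw [hdim] at hIcard' ⊢
        push_cast at hIcard' ⊢
        nlinarith
  · have hPT' : P ⊆ T' := by
      intro x hx
      rcases Finset.mem_insert.1 (hPT hx) with rfl | h
      · exact absurd hx hvP
      · exact h
    have ih' := ih P hPT' hP
    have hmono : P + T' ⊆ P + insert v T' := Finset.add_subset_add_left (Finset.subset_insert _ _)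
    rcases hdim with hdim | ⟨hdim, -, hne⟩
    · obtain ⟨u, hu, hmin⟩ := P.exists_min_image f hP
      have h1 : (P + T').card + 1 ≤ (P + insert v T').card := by
        refine Finset.card_lt_card (hmono.ssubset_of_mem_notMem (a := u + v)
          (Finset.add_mem_add hu (Finset.mem_insert_self _ _)) fun h => ?_)
        obtain ⟨a, ha, b, hb, hab⟩ := Finset.mem_add.1 h
        have hfab : f a + f b = f u + f v := by rw [← map_add, hab, map_add]
        have h1 := hmin a ha
        have h2 := hv b hb
        linarith
      have h1' : ((P + T').card : ℝ) + 1 ≤ (P + insert v T').card := by exact_mod_cast h1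
      rw [hdim]
      push_cast
      linarith
    · have h1 : (P + T').card + P.card ≤ (P + insert v T').card := by
        rw [← Finset.card_image_of_injective P (add_right_injective v),
          ← Finset.card_union_of_disjoint]
        · refine Finset.card_le_card (Finset.union_subset hmono fun x hx => ?_)
          obtain ⟨t, ht, rfl⟩ := Finset.mem_image.1 hx
          rw [add_comm v t]
          exact Finset.add_mem_add ht (Finset.mem_insert_self _ _)
        · rw [Finset.disjoint_right]
          intro x hx h
          obtain ⟨t, ht, rfl⟩ := Finset.mem_image.1 hx
          obtain ⟨a, ha, b, hb, hab⟩ := Finset.mem_add.1 h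
          exact hne t (hPT' ht) a (hPT' ha) b hb hab.symm
      have h1' : ((P + T').card : ℝ) + P.card ≤ (P + insert v T').card := by exact_mod_cast h1
      rw [hdim]
      push_cast
      have : (0 : ℝ) ≤ affineRank T' := Nat.cast_nonneg _
      linarith

theorem rank_mul_add_le_sum {T : Finset M} {w₀ : ℝ} (w α : M → ℝ) (t₀ : M) (ht₀ : t₀ ∈ T)
    (hw : ∀ t ∈ T, 0 ≤ w t) (hw₀ : ∀ t ∈ T, w t ≤ w₀) (hwt₀ : w t₀ = w₀)
    (hα : ∀ s ∈ T, ∀ t ∈ T, w s ≤ α (s + t)) :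
    affineRank T * ∑ t ∈ T, w t +
      (T.card - affineRank T * (affineRank T + 1) / 2 : ℝ) * w₀ ≤ ∑ x ∈ T + T, α x := by
  induction hn : (T.filter fun t => 0 < w t).card using Nat.strong_induction_on
    generalizing w α w₀ with
  | _ n ih =>
  set P := T.filter fun t => 0 < w t with hPdef
  have hPT : P ⊆ T := Finset.filter_subset _ _
  rcases P.eq_empty_or_nonempty with hP | hP
  · have h0 : ∀ t ∈ T, w t = 0 := by
      intro t ht
      refine le_antisymm (not_lt.1 fun h => ?_) (hw t ht)
      exact Finset.notMem_empty t (hP ▸ Finset.mem_filter.2 ⟨ht, h⟩)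
    have h1 : w₀ = 0 := by rw [← hwt₀, h0 t₀ ht₀]
    rw [Finset.sum_eq_zero h0, h1]
    simp only [mul_zero, add_zero]
    refine Finset.sum_nonneg fun x hx => ?_
    obtain ⟨a, ha, b, hb, rfl⟩ := Finset.mem_add.1 hx
    exact (hw a ha).trans (hα a ha b hb)
  · obtain ⟨u, hu, hmin⟩ := P.exists_min_image w hP
    have hu' := (Finset.mem_filter.1 hu)
    set μ := w u
    have hμ : 0 < μ := hu'.2
    have ht₀P : t₀ ∈ P := by
      refine Finset.mem_filter.2 ⟨ht₀, ?_⟩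
      rw [hwt₀]
      exact hμ.trans_le (hw₀ u hu'.1)
    set w' : M → ℝ := fun t => w t - if t ∈ P then μ else 0 with hw'
    set α' : M → ℝ := fun x => α x - if x ∈ P + T then μ else 0 with hα'
    have hw'0 : ∀ t ∈ T, 0 ≤ w' t := by
      intro t ht
      by_cases h : t ∈ P
      · simp only [hw', h, if_true]; linarith [hmin t h]
      · simp only [hw', h, if_false]; linarith [hw t ht]
    have hlt : (T.filter fun t => 0 < w' t).card < n := by
      rw [← hn]
      refine Finset.card_lt_card (Finset.ssubset_iff_of_subset ?_ |>.2 ⟨u, hu, ?_⟩)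
      · intro t ht
        rw [Finset.mem_filter] at ht
        refine Finset.mem_filter.2 ⟨ht.1, ht.2.trans_le ?_⟩
        simp only [hw']
        split_ifs <;> linarith
      · simp [hw', hu, μ]
    have key := ih _ hlt (w₀ := w₀ - μ) w' α' hw'0 ?_ ?_ ?_ rfl
    · have e1 : ∑ t ∈ T, w' t = ∑ t ∈ T, w t - P.card * μ := by
        simp only [hw', Finset.sum_sub_distrib]
        rw [← Finset.sum_filter, Finset.filter_mem_eq_inter, Finset.inter_eq_right.2 hPT]
        simp
      have e2 : ∑ x ∈ T + T, α' x = ∑ x ∈ T + T, α x - (P + T).card * μ := by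
        simp only [hα', Finset.sum_sub_distrib]
        rw [← Finset.sum_filter, Finset.filter_mem_eq_inter,
          Finset.inter_eq_right.2 (Finset.add_subset_add_right hPT)]
        simp
      rw [e1, e2] at key
      have hR := mul_le_mul_of_nonneg_right (card_add_rank_mul_le T P hPT hP) hμ.le
      linarith
    · intro t ht
      by_cases h : t ∈ P
      · simp only [hw', h, if_true]; linarith [hw₀ t ht]
      · have h1 : ¬ 0 < w t := fun h' => h (Finset.mem_filter.2 ⟨ht, h'⟩)
        simp only [hw', h, if_false]
        linarith [hw₀ u hu'.1]
    · simp [hw', ht₀P, hwt₀]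
    · intro s hs t ht
      by_cases h : s ∈ P
      · simp only [hw', hα', h, Finset.add_mem_add h ht, if_true]
        linarith [hα s hs t ht]
      · have h1 : ¬ 0 < w s := fun h' => h (Finset.mem_filter.2 ⟨hs, h'⟩)
        simp only [hw', hα', h, if_false]
        split_ifs with h2
        · obtain ⟨a, ha, b, hb, hab⟩ := Finset.mem_add.1 h2
          have h3 := hα a (hPT ha) b hb
          rw [hab] at h3
          linarith [hmin a ha]
        · linarith [hα s hs t ht]

theorem rank_add_one_mul_le {T : Finset M} {w g : M → ℝ} {w₀ : ℝ} {t₀ : M} (ht₀ : t₀ ∈ T)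
    (hw : ∀ t ∈ T, 0 ≤ w t) (hw₀ : ∀ t ∈ T, w t ≤ w₀) (hwt₀ : w t₀ = w₀)
    (hwg : ∀ s ∈ T, ∀ t ∈ T, w s + w t ≤ g (s + t)) :
    (affineRank T + 1) * ∑ t ∈ T, w t +
      (T.card - affineRank T * (affineRank T + 1) / 2 : ℝ) * w₀ ≤ ∑ x ∈ T + T, g x := by
  have key := rank_mul_add_le_sum w (fun x => g x - if x ∈ T.image (t₀ + ·) then w (x - t₀) else 0)
    t₀ ht₀ hw hw₀ hwt₀ ?_
  · rw [Finset.sum_sub_distrib, ← Finset.sum_filter, Finset.filter_mem_eq_inter,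
      Finset.inter_eq_right.2, Finset.sum_image fun x _ y _ h => add_left_cancel h] at key
    · simp only [add_sub_cancel_left] at key
      linarith
    · intro x hx
      obtain ⟨t, ht, rfl⟩ := Finset.mem_image.1 hx
      exact Finset.add_mem_add ht₀ ht
  · intro s hs t ht
    split_ifs with h
    · obtain ⟨u, hu, hut⟩ := Finset.mem_image.1 h
      rw [← hut, add_sub_cancel_left]
      linarith [hwg t₀ ht₀ u hu, hw₀ s hs]
    · linarith [hwg s hs t ht, hw t ht]

theorem rank_add_two_mul_le {T : Finset M} {w g : M → ℝ}
    (hcard : (affineRank T + 2) ^ 2 < T.card)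
    (hw : ∀ t ∈ T, 0 ≤ w t) (hg : ∀ x, 0 ≤ g x)
    (hwg : ∀ s ∈ T, ∀ t ∈ T, w s + w t ≤ g (s + t)) :
    (affineRank T + 2 + 1 / 12) * ∑ t ∈ T, w t ≤ ∑ x ∈ T + T, g x := by
  have hT : T.Nonempty := Finset.card_pos.1 (by omega)
  obtain ⟨t₀, ht₀, hmax⟩ := T.exists_max_image w hT
  have h1 := rank_add_three_mul_le hT hw hmax hg hwg
  have h2 := rank_add_one_mul_le ht₀ hw hmax rfl hwg
  have hc : ((affineRank T : ℝ) + 2) ^ 2 + 1 ≤ T.card := by exact_mod_cast hcard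
  have hm : (0 : ℝ) ≤ affineRank T := Nat.cast_nonneg _
  have h0 := hw t₀ ht₀
  by_cases hcase : (affineRank T + 1 : ℝ) * w t₀ ≤ 11 / 12 * ∑ t ∈ T, w t
  · linarith
  · push Not at hcase
    have h3 : (13 / 11 * (affineRank T + 1 : ℝ)) * w t₀ ≤
        (T.card - affineRank T * (affineRank T + 1) / 2 : ℝ) * w t₀ := by
      refine mul_le_mul_of_nonneg_right ?_ h0
      nlinarith
    linarith

end Weighted

theorem exists_notMem_corner {F : Finset (ℕ × ℕ)} (hF : F.card < 1275) :
    ∃ a b, a < 50 ∧ b < 50 ∧ (a, b) ∉ F ∧ (a + b) * (a + b + 1) ≤ 2 * F.card := by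
  have htri : ∀ t : ℕ, 2 * (((Finset.range t).biUnion fun n =>
      Finset.HasAntidiagonal.antidiagonal n).card) = t * (t + 1) := by
    intro t
    rw [Finset.card_biUnion]
    · simp only [Finset.Nat.card_antidiagonal]
      induction t with
      | zero => simp
      | succ t ih => rw [Finset.sum_range_succ]; linarith
    · intro m _ n _ hmn
      exact Finset.disjoint_left.2 fun x hx hx' => hmn (by
        simp only [Finset.HasAntidiagonal.mem_antidiagonal] at hx hx'; omega)
  have hmem : ∀ t : ℕ, ∀ p : ℕ × ℕ, p ∈ ((Finset.range t).biUnion fun n =>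
      Finset.HasAntidiagonal.antidiagonal n) ↔ p.1 + p.2 < t := by
    intro t p
    simp
  obtain ⟨p, hp⟩ : ((((Finset.range 50).biUnion fun n =>
      Finset.HasAntidiagonal.antidiagonal n)) \ F).Nonempty := by
    rw [Finset.sdiff_nonempty]
    intro h
    have h1 := Finset.card_le_card h
    have h2 := htri 50
    omega
  obtain ⟨q, hq, hmin⟩ := Finset.exists_min_image _ (fun p : ℕ × ℕ => p.1 + p.2) ⟨p, hp⟩
  rw [Finset.mem_sdiff, hmem] at hq
  refine ⟨q.1, q.2, by omega, by omega, hq.2, ?_⟩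
  rw [← htri]
  refine Nat.mul_le_mul_left 2 (Finset.card_le_card fun x hx => ?_)
  rw [hmem] at hx
  by_contra hxF
  have := hmin x (Finset.mem_sdiff.2 ⟨(hmem _ _).2 (by omega), hxF⟩)
  omega

theorem exists_notMem_four_corners {E : Finset (ℕ × ℕ)} (hE : E.card ≤ 1020) :
    ∃ a₁ b₁ a₂ b₂ a₃ b₃ a₄ b₄ : ℕ, a₁ < 50 ∧ b₁ < 50 ∧ a₂ < 50 ∧ b₂ < 50 ∧ a₃ < 50 ∧ b₃ < 50 ∧
      a₄ < 50 ∧ b₄ < 50 ∧ (a₁, b₁) ∉ E ∧ (99 - a₂, 99 - b₂) ∉ E ∧ (99 - a₃, b₃) ∉ E ∧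
      (a₄, 99 - b₄) ∉ E ∧ a₁ + b₁ + a₂ + b₂ + a₃ + b₃ + a₄ + b₄ < 92 := by
  have hcard : ∀ r : ℕ × ℕ → ℕ × ℕ, ∀ (p : ℕ × ℕ → Prop) [DecidablePred p],
      (∀ x : ℕ × ℕ, x.1 < 50 → x.2 < 50 → p (r x) ∧ r (r x) = x) →
      ∃ a b, a < 50 ∧ b < 50 ∧ r (a, b) ∉ E ∧ (a + b) * (a + b + 1) ≤ 2 * (E.filter p).card := by
    intro r p _ hr
    set F := ((E.filter p).image r).filter fun x => x.1 < 50 ∧ x.2 < 50 with hF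
    have hFE : F.card ≤ (E.filter p).card :=
      (Finset.card_filter_le _ _).trans Finset.card_image_le
    have h1 := Finset.card_filter_le E p
    obtain ⟨a, b, ha, hb, hab, hle⟩ := exists_notMem_corner (F := F) (by omega)
    refine ⟨a, b, ha, hb, fun h => hab ?_, hle.trans (Nat.mul_le_mul_left 2 hFE)⟩
    have h2 := hr (a, b) ha hb
    exact Finset.mem_filter.2 ⟨Finset.mem_image.2 ⟨_, Finset.mem_filter.2 ⟨h, h2.1⟩, h2.2⟩, ha, hb⟩
  obtain ⟨a₁, b₁, ha₁, hb₁, h₁, hs₁⟩ := hcard id (fun x => x.1 < 50 ∧ x.2 < 50)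
    fun x h h' => ⟨⟨h, h'⟩, rfl⟩
  obtain ⟨a₂, b₂, ha₂, hb₂, h₂, hs₂⟩ := hcard (fun x => (99 - x.1, 99 - x.2))
    (fun x => ¬ x.1 < 50 ∧ ¬ x.2 < 50)
    fun x h h' => ⟨⟨by simp only; omega, by simp only; omega⟩, by ext <;> simp only <;> omega⟩
  obtain ⟨a₃, b₃, ha₃, hb₃, h₃, hs₃⟩ := hcard (fun x => (99 - x.1, x.2))
    (fun x => ¬ x.1 < 50 ∧ x.2 < 50)
    fun x h h' => ⟨⟨by simp only; omega, h'⟩, by ext <;> simp only; omega⟩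
  obtain ⟨a₄, b₄, ha₄, hb₄, h₄, hs₄⟩ := hcard (fun x => (x.1, 99 - x.2))
    (fun x => x.1 < 50 ∧ ¬ x.2 < 50)
    fun x h h' => ⟨⟨h, by simp only; omega⟩, by ext <;> simp only; omega⟩
  refine ⟨a₁, b₁, a₂, b₂, a₃, b₃, a₄, b₄, ha₁, hb₁, ha₂, hb₂, ha₃, hb₃, ha₄, hb₄, h₁, h₂, h₃, h₄, ?_⟩
  have hsum : (E.filter fun x => x.1 < 50 ∧ x.2 < 50).card +
      (E.filter fun x => ¬ x.1 < 50 ∧ ¬ x.2 < 50).card +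
      (E.filter fun x => ¬ x.1 < 50 ∧ x.2 < 50).card +
      (E.filter fun x => x.1 < 50 ∧ ¬ x.2 < 50).card = E.card := by
    have e1 := Finset.card_filter_add_card_filter_not (s := E) (fun x => x.1 < 50)
    have e2 := Finset.card_filter_add_card_filter_not
      (s := E.filter fun x => x.1 < 50) (fun x => x.2 < 50)
    have e3 := Finset.card_filter_add_card_filter_not
      (s := E.filter fun x => ¬ x.1 < 50) (fun x => x.2 < 50)
    simp only [Finset.filter_filter] at e2 e3
    omega
  by_contra! hcon
  generalize hx₁ : a₁ + b₁ = x₁ at *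
  generalize hx₂ : a₂ + b₂ = x₂ at *
  generalize hx₃ : a₃ + b₃ = x₃ at *
  generalize hx₄ : a₄ + b₄ = x₄ at *
  have h92 : 92 ≤ x₁ + x₂ + x₃ + x₄ := by omega
  have htot : x₁ * (x₁ + 1) + x₂ * (x₂ + 1) + x₃ * (x₃ + 1) + x₄ * (x₄ + 1) ≤ 2040 := by omega
  clear hcard hs₁ hs₂ hs₃ hs₄ hsum h₁ h₂ h₃ h₄
  zify at h92 htot
  nlinarith [sq_nonneg ((x₁ : ℤ) - 23), sq_nonneg ((x₂ : ℤ) - 23), sq_nonneg ((x₃ : ℤ) - 23),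
    sq_nonneg ((x₄ : ℤ) - 23)]

theorem det_updateCol_one {n : Type*} [Fintype n] [DecidableEq n] (i : n) (x : n → ℝ) :
    ((1 : Matrix n n ℝ).updateCol i x).det = x i := by
  rw [← Matrix.cramer_apply, Matrix.cramer_one]
  rfl

theorem det_updateCol_updateCol_one {n : Type*} [Fintype n] [DecidableEq n] {i j : n}
    (hij : i ≠ j) (x y : n → ℝ) :
    (((1 : Matrix n n ℝ).updateCol i x).updateCol j y).det = x i * y j - x j * y i := by
  set M := (1 : Matrix n n ℝ).updateCol i x with hM
  have h1 : M.cramer y i = y i := by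
    rw [Matrix.cramer_apply, hM, Matrix.updateCol_idem, det_updateCol_one]
  have h2 := congrFun (Matrix.mulVec_cramer M y) j
  have h3 : (M.mulVec (M.cramer y)) j = x j * M.cramer y i + M.cramer y j := by
    rw [Matrix.mulVec, dotProduct, ← Finset.add_sum_erase _ _ (Finset.mem_univ i),
      ← Finset.add_sum_erase _ _ (Finset.mem_erase.2 ⟨hij.symm, Finset.mem_univ j⟩)]
    rw [Finset.sum_eq_zero]
    · simp [hM, hij.symm]
    · intro l hl
      simp only [Finset.mem_erase] at hl
      simp [hM, hl.2.1, Matrix.one_apply_ne hl.1.symm]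
  rw [h3, h1, hM, det_updateCol_one] at h2
  simp only [Pi.smul_apply, smul_eq_mul] at h2
  rw [← hM] at h2
  rw [← Matrix.cramer_apply]
  linarith

theorem exists_normalizing_equiv {k : ℕ} {A : Finset (Fin k → ℝ)}
    (hspan : ∀ φ : (Fin k → ℝ) →ₗ[ℝ] ℝ, φ ≠ 0 → ∃ a ∈ A, ∃ b ∈ A, φ a ≠ φ b) :
    ∃ L : (Fin k → ℝ) ≃ₗ[ℝ] (Fin k → ℝ),
      (∀ i, ∃ a ∈ A, ∃ b ∈ A, L b - L a = Pi.single i 1) ∧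
      ∀ u : Fin k → Fin k → ℝ, (∀ j, ∃ a ∈ A, ∃ b ∈ A, u j = L b - L a) →
        |(Matrix.of u).det| ≤ 1 := by
  set D : Finset (Fin k → ℝ) := A - A with hD
  have htop : Submodule.span ℝ (D : Set (Fin k → ℝ)) = ⊤ := by
    by_contra hne
    obtain ⟨φ, hφ, hker⟩ := Submodule.exists_le_ker_of_lt_top _ (lt_top_iff_ne_top.2 hne)
    obtain ⟨a, ha, b, hb, hab⟩ := hspan φ hφ
    have h1 : a - b ∈ LinearMap.ker φ :=
      hker (Submodule.subset_span (Finset.mem_coe.2 (Finset.sub_mem_sub ha hb)))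
    rw [LinearMap.mem_ker, map_sub, sub_eq_zero] at h1
    exact hab h1
  obtain ⟨w, hwD, -, hw⟩ := Submodule.exists_fun_fin_finrank_span_eq ℝ (D : Set (Fin k → ℝ))
  have hrank : Module.finrank ℝ (Submodule.span ℝ (D : Set (Fin k → ℝ))) = k := by
    rw [htop, finrank_top, Module.finrank_fin_fun]
  set w' : Fin k → Fin k → ℝ := fun i => w (Fin.cast hrank.symm i) with hw'
  have hw'i : LinearIndependent ℝ w' := hw.comp _ (Fin.cast_injective _)
  obtain ⟨u, hu, hmax⟩ := (Fintype.piFinset fun _ : Fin k => D).exists_max_image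
    (fun u => |(Matrix.of u).det|) ⟨w', Fintype.mem_piFinset.2 fun i => hwD _⟩
  rw [Fintype.mem_piFinset] at hu
  have hdet : 0 < |(Matrix.of u).det| := by
    refine lt_of_lt_of_le (abs_pos.2 ?_) (hmax w' (Fintype.mem_piFinset.2 fun i => hwD _))
    have := (Matrix.linearIndependent_rows_iff_isUnit (A := Matrix.of w')).1 hw'i
    exact ((Matrix.isUnit_iff_isUnit_det _).1 this).ne_zero
  have hui : LinearIndependent ℝ u := by
    have := (Matrix.linearIndependent_rows_iff_isUnit (A := Matrix.of u)).2
      ((Matrix.isUnit_iff_isUnit_det _).2 (isUnit_iff_ne_zero.2 (abs_pos.1 hdet)))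
    exact this
  set B := basisOfLinearIndependentOfCardEqFinrank' u hui (by simp) with hB
  have hBu : ∀ i, B i = u i := fun i => by
    rw [hB, coe_basisOfLinearIndependentOfCardEqFinrank']
  refine ⟨B.equivFun, fun i => ?_, fun x hx => ?_⟩
  · obtain ⟨b, hb, a, ha, hab⟩ := Finset.mem_sub.1 (hu i)
    refine ⟨a, ha, b, hb, ?_⟩
    rw [← map_sub, hab, ← hBu]
    ext j
    rw [B.equivFun_self, Pi.single_apply]
    simp [eq_comm]
  · choose a ha b hb hab using hx
    have h1 := hmax (fun j => b j - a j)
      (Fintype.mem_piFinset.2 fun j => Finset.sub_mem_sub (hb j) (ha j))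
    have h2 : Matrix.of (fun j => b j - a j) = Matrix.of x * Matrix.of u := by
      ext i j
      have h3 := congrFun (B.sum_equivFun (b i - a i)) j
      rw [Matrix.mul_apply, Matrix.of_apply, ← h3]
      simp [hBu, hab]
    simp only [h2, Matrix.det_mul, abs_mul] at h1
    by_contra! h4
    nlinarith

theorem exists_unit_box_equiv {k : ℕ} {A : Finset (Fin k → ℝ)}
    (hspan : ∀ φ : (Fin k → ℝ) →ₗ[ℝ] ℝ, φ ≠ 0 → ∃ a ∈ A, ∃ b ∈ A, φ a ≠ φ b) :
    ∃ L : (Fin k → ℝ) ≃ₗ[ℝ] (Fin k → ℝ),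
      (∀ i, ∃ a ∈ A.image L, a + Pi.single i 1 ∈ A.image L) ∧
      (∀ i, ∀ a ∈ A.image L, ∀ b ∈ A.image L, b i - a i ≤ 1) ∧
      ∀ i j, i ≠ j → ∀ a ∈ A.image L, ∀ b ∈ A.image L, ∀ a' ∈ A.image L, ∀ b' ∈ A.image L,
        (b - a) i * (b' - a') j - (b - a) j * (b' - a') i ≤ 1 := by
  obtain ⟨L, hL, hdet⟩ := exists_normalizing_equiv hspan
  refine ⟨L, fun i => ?_, fun i a' ha' b' hb' => ?_,
    fun i j hij x₁ hx₁ y₁ hy₁ x₂ hx₂ y₂ hy₂ => ?_⟩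
  · obtain ⟨a, ha, b, hb, hab⟩ := hL i
    refine ⟨L a, Finset.mem_image_of_mem _ ha, ?_⟩
    rw [← hab, add_sub_cancel]
    exact Finset.mem_image_of_mem _ hb
  · obtain ⟨a, ha, rfl⟩ := Finset.mem_image.1 ha'
    obtain ⟨b, hb, rfl⟩ := Finset.mem_image.1 hb'
    have h1 := hdet (((1 : Matrix (Fin k) (Fin k) ℝ).updateCol i (L b - L a)).transpose) ?_
    · have h2 : (Matrix.of (((1 : Matrix (Fin k) (Fin k) ℝ).updateCol i
        (L b - L a)).transpose)).det = (L b - L a) i := by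
        exact (Matrix.det_transpose _).trans (det_updateCol_one i _)
      rw [h2] at h1
      exact (le_abs_self _).trans h1
    · intro j
      by_cases hj : j = i
      · refine ⟨a, ha, b, hb, ?_⟩
        ext l
        simp [Matrix.transpose_apply, hj]
      · obtain ⟨a', ha', b', hb', hab'⟩ := hL j
        refine ⟨a', ha', b', hb', ?_⟩
        rw [hab']
        ext l
        simp [Matrix.transpose_apply, hj, Matrix.one_apply,
          Pi.single_apply]
  · obtain ⟨a₁, ha₁, rfl⟩ := Finset.mem_image.1 hx₁
    obtain ⟨b₁, hb₁, rfl⟩ := Finset.mem_image.1 hy₁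
    obtain ⟨a₂, ha₂, rfl⟩ := Finset.mem_image.1 hx₂
    obtain ⟨b₂, hb₂, rfl⟩ := Finset.mem_image.1 hy₂
    have h1 := hdet ((((1 : Matrix (Fin k) (Fin k) ℝ).updateCol i (L b₁ - L a₁)).updateCol j
      (L b₂ - L a₂)).transpose) ?_
    · have h2 : (Matrix.of ((((1 : Matrix (Fin k) (Fin k) ℝ).updateCol i (L b₁ - L a₁)).updateCol j
          (L b₂ - L a₂)).transpose)).det = _ :=
        (Matrix.det_transpose _).trans (det_updateCol_updateCol_one hij (L b₁ - L a₁) (L b₂ - L a₂))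
      rw [h2] at h1
      exact (le_abs_self _).trans h1
    · intro l
      by_cases hl : l = j
      · refine ⟨a₂, ha₂, b₂, hb₂, ?_⟩
        ext
        simp [Matrix.transpose_apply, hl]
      by_cases hl' : l = i
      · refine ⟨a₁, ha₁, b₁, hb₁, ?_⟩
        ext
        simp [Matrix.transpose_apply, hl', hij]
      · obtain ⟨a', ha', b', hb', hab'⟩ := hL l
        refine ⟨a', ha', b', hb', ?_⟩
        rw [hab']
        ext
        simp [Matrix.transpose_apply, hl, hl', Matrix.one_apply,
          Pi.single_apply]

theorem mem_add_singleton_iff {G : Type*} [AddCommGroup G] [DecidableEq G] {B : Finset G}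
    {a x : G} : x ∈ B + {a} ↔ x - a ∈ B := by
  constructor
  · intro h
    obtain ⟨b, hb, c, hc, rfl⟩ := Finset.mem_add.1 h
    rw [Finset.mem_singleton] at hc
    simpa [hc] using hb
  · exact fun h => Finset.mem_add.2 ⟨_, h, a, Finset.mem_singleton_self a, sub_add_cancel x a⟩

theorem exists_addSubgroup_of_large_inter {G : Type*} [AddCommGroup G] [DecidableEq G]
    {B : Finset G} {N : ℝ} (hB : B.Nonempty) (hBN : (B.card : ℝ) ≤ N)
    (hinter : ∀ a ∈ B, ∀ b ∈ B, 11 / 12 * N ≤ ((B + {a}) ∩ (B + {b})).card) :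
    ∃ (H : AddSubgroup G) (F : Finset G), (F : Set G) = H ∧
      (∀ a ∈ B, ∀ b ∈ B, a - b ∈ H) ∧ 11 / 12 * (F.card : ℝ) ≤ N ∧
      ∀ h ∈ H, 11 / 12 * N ≤ (B ∩ (B + {h})).card := by
  have hN : 0 < N := lt_of_lt_of_le (by exact_mod_cast hB.card_pos) hBN
  have hsub : ∀ h ∈ B - B, 11 / 12 * N ≤ (B ∩ (B + {h})).card := by
    intro h hh
    obtain ⟨a, ha, b, hb, rfl⟩ := Finset.mem_sub.1 hh
    refine (hinter b hb a ha).trans_eq ?_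
    rw [← Finset.card_add_singleton (B ∩ (B + {a - b})) b]
    congr 2
    ext x
    simp only [Finset.mem_inter, mem_add_singleton_iff]
    rw [sub_sub, add_sub_cancel]
  have hadd : ∀ {x y}, x ∈ B - B → y ∈ B - B → x + y ∈ B - B := by
    intro x y hx hy
    have h1 := hsub x hx
    have h2 := hsub y hy
    have h3 : ((B ∩ (B + {x})) ∩ ((B ∩ (B + {y})) + {x})).Nonempty := by
      by_contra hne
      rw [Finset.not_nonempty_iff_eq_empty, ← Finset.disjoint_iff_inter_eq_empty] at hne
      have h4 := Finset.card_union_of_disjoint hne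
      have h5 : (B ∩ (B + {x})) ∪ ((B ∩ (B + {y})) + {x}) ⊆ B + {x} :=
        Finset.union_subset Finset.inter_subset_right
          (Finset.add_subset_add_right Finset.inter_subset_left)
      have h6 := Finset.card_le_card h5
      rw [h4, Finset.card_add_singleton, Finset.card_add_singleton] at h6
      have h7 : ((B ∩ (B + {x})).card : ℝ) + (B ∩ (B + {y})).card ≤ B.card := by
        exact_mod_cast h6
      linarith
    obtain ⟨z, hz⟩ := h3
    simp only [Finset.mem_inter, mem_add_singleton_iff] at hz
    exact Finset.mem_sub.2 ⟨z, hz.1.1, _, hz.2.2, by abel⟩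
  refine ⟨{ carrier := ((B - B : Finset G) : Set G)
            add_mem' := hadd
            zero_mem' := ?_
            neg_mem' := ?_ }, B - B, rfl, fun a ha b hb => Finset.sub_mem_sub ha hb, ?_, hsub⟩
  · obtain ⟨b, hb⟩ := hB
    exact Finset.mem_coe.2 (Finset.mem_sub.2 ⟨b, hb, b, hb, sub_self b⟩)
  · intro x hx
    obtain ⟨a, ha, b, hb, rfl⟩ := Finset.mem_sub.1 (Finset.mem_coe.1 hx)
    exact Finset.mem_coe.2 (Finset.mem_sub.2 ⟨b, hb, a, ha, by abel⟩)
  · have h1 : ∑ h ∈ B - B, (B ∩ (B + {h})).card ≤ B.card * B.card := by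
      rw [← Finset.card_product, ← Finset.card_sigma]
      refine Finset.card_le_card_of_injOn (fun p => (p.2, p.2 - p.1)) ?_ ?_
      · rintro ⟨h, x⟩ hx
        simp only [Finset.coe_sigma, Set.mem_sigma_iff, Finset.mem_coe, Finset.mem_inter,
          mem_add_singleton_iff] at hx
        simpa using hx.2
      · rintro ⟨h, x⟩ - ⟨h', x'⟩ - hxy
        simp only [Prod.mk.injEq] at hxy
        obtain ⟨rfl, h2⟩ := hxy
        rw [sub_right_inj] at h2
        rw [h2]
    have h2 : ((B - B).card : ℝ) * (11 / 12 * N) ≤ B.card * B.card := by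
      calc ((B - B).card : ℝ) * (11 / 12 * N) = ∑ h ∈ B - B, 11 / 12 * N := by simp
        _ ≤ ∑ h ∈ B - B, ((B ∩ (B + {h})).card : ℝ) := Finset.sum_le_sum hsub
        _ ≤ _ := by exact_mod_cast h1
    have h3 : (B.card : ℝ) * B.card ≤ N * N := by gcongr
    nlinarith

/-- The coordinatewise projection of `ℝ^k` onto the torus `(ℝ / ℤ)^k`. -/
noncomputable def toTorus (k : ℕ) : (Fin k → ℝ) →+ (Fin k → AddCircle (1 : ℝ)) :=
  AddMonoidHom.mk' (fun x i => (x i : AddCircle (1 : ℝ))) fun x y => by ext i; simp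

theorem toTorus_apply {k : ℕ} (x : Fin k → ℝ) (i : Fin k) :
    toTorus k x i = (x i : AddCircle (1 : ℝ)) := rfl

theorem exists_int_of_toTorus_eq {k : ℕ} {x y : Fin k → ℝ} (h : toTorus k x = toTorus k y)
    (i : Fin k) : ∃ n : ℤ, y i = x i + n := by
  have h1 := congrFun h i
  rw [toTorus_apply, toTorus_apply, QuotientAddGroup.eq, AddSubgroup.mem_zmultiples_iff] at h1
  obtain ⟨n, hn⟩ := h1
  exact ⟨n, by simp at hn; linarith⟩

theorem eq_of_toTorus_eq {k : ℕ} {c x y : Fin k → ℝ} (hx : ∀ i, c i ≤ x i ∧ x i < c i + 1)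
    (hy : ∀ i, c i ≤ y i ∧ y i < c i + 1) (h : toTorus k x = toTorus k y) : x = y := by
  ext i
  obtain ⟨n, hn⟩ := exists_int_of_toTorus_eq h i
  have h1 : (n : ℝ) < 1 := by linarith [(hx i).1, (hy i).2]
  have h2 : (-1 : ℝ) < n := by linarith [(hx i).2, (hy i).1]
  have h3 : n < 1 := by exact_mod_cast h1
  have h4 : -1 < n := by exact_mod_cast h2
  have h5 : n = 0 := by omega
  simp [hn, h5]

/-- The projection that annihilates the coordinates in `J`. -/
noncomputable def zeroOn {k : ℕ} (J : Finset (Fin k)) : (Fin k → ℝ) →+ (Fin k → ℝ) :=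
  AddMonoidHom.mk' (fun x i => if i ∈ J then 0 else x i) fun x y => by
    ext i; by_cases h : i ∈ J <;> simp [h]

theorem zeroOn_apply {k : ℕ} (J : Finset (Fin k)) (x : Fin k → ℝ) (i : Fin k) :
    zeroOn J x i = if i ∈ J then 0 else x i := rfl

theorem toTorus_single {k : ℕ} (i : Fin k) : toTorus k (Pi.single i 1) = 0 := by
  ext j
  rw [toTorus_apply, Pi.single_apply]
  split_ifs
  · exact AddCircle.coe_period 1
  · simp

theorem mul_card_add_card_image_toTorus_le {k : ℕ} {A S : Finset (Fin k → ℝ)}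
    (a : Fin k → Fin k → ℝ) (hA : Set.InjOn (toTorus k) A) (h₀ : ∀ i, ∀ x ∈ A, x + a i ∈ S)
    (h₁ : ∀ i, ∀ x ∈ A, x + a i + Pi.single i 1 ∈ S) :
    k * A.card + (S.image (toTorus k)).card ≤ S.card := by
  have key : ∀ J : Finset (Fin k),
      J.card * A.card + (S.image ((zeroOn J).prod (toTorus k))).card ≤ S.card := by
    intro J
    induction J using Finset.induction_on with
    | empty => simpa using Finset.card_image_le
    | insert i J hi ih =>
      set Ψ := (zeroOn J).prod (toTorus k) with hΨ
      set q := (zeroOn {i}).prodMap (AddMonoidHom.id (Fin k → AddCircle (1 : ℝ))) with hq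
      have hqΨ : ∀ x, q (Ψ x) = (zeroOn (insert i J)).prod (toTorus k) x := by
        intro x
        refine Prod.ext (funext fun j => ?_) rfl
        change (if j ∈ ({i} : Finset (Fin k)) then 0 else if j ∈ J then 0 else x j) =
          if j ∈ insert i J then 0 else x j
        by_cases h1 : j = i <;> by_cases h2 : j ∈ J <;> simp [h1, h2]
      have hstep := card_add_card_image_le q (v := Ψ (Pi.single i 1))
        (A := (A.image (· + a i)).image Ψ) (S := S.image Ψ) ?_ ?_ ?_ ?_
      · have e1 : ((A.image (· + a i)).image Ψ).card = A.card := by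
          rw [Finset.image_image, Finset.card_image_of_injOn]
          intro x hx y hy hxy
          have h2 := congrArg Prod.snd hxy
          exact hA hx hy (by simpa [hΨ] using h2)
        have e2 : (S.image Ψ).image q = S.image ((zeroOn (insert i J)).prod (toTorus k)) := by
          rw [Finset.image_image]
          exact Finset.image_congr fun x _ => hqΨ x
        rw [e1, e2] at hstep
        rw [Finset.card_insert_of_notMem hi, add_mul, one_mul]
        omega
      · rw [hqΨ]
        refine Prod.ext (funext fun j => ?_) (toTorus_single i)
        change (if j ∈ insert i J then 0 else (Pi.single i 1 : Fin k → ℝ) j) = 0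
        by_cases h1 : j = i <;> simp [h1]
      · intro n hn h
        have h2 := congrFun (congrArg Prod.fst h) i
        simp [hΨ, zeroOn_apply, hi, hn] at h2
      · refine Finset.image_subset_image fun x hx => ?_
        obtain ⟨y, hy, rfl⟩ := Finset.mem_image.1 hx
        exact h₀ i y hy
      · intro x hx
        rw [Finset.image_image] at hx
        obtain ⟨y, hy, rfl⟩ := Finset.mem_image.1 hx
        rw [Function.comp_apply, ← map_add]
        exact Finset.mem_image_of_mem _ (h₁ i y hy)
  have h1 := key Finset.univ
  rw [Finset.card_univ, Fintype.card_fin] at h1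
  have h2 : (S.image (toTorus k)).card ≤
      (S.image ((zeroOn Finset.univ).prod (toTorus k))).card := by
    have : S.image (toTorus k) =
        (S.image ((zeroOn Finset.univ).prod (toTorus k))).image Prod.snd := by
      rw [Finset.image_image]; rfl
    rw [this]
    exact Finset.card_image_le
  omega

theorem exists_large_add_or_addSubgroup {k N : ℕ} {δ : ℝ} {A : Finset (Fin k → ℝ)}
    (hA : A.Nonempty) (hk : 1 ≤ k) (hδ : k * (k * δ) ≤ 1 / 1000)
    (hN : (k + 2 : ℝ) < N * (1 / 1000)) (a : Fin k → Fin k → ℝ) (ha : ∀ i, a i ∈ A)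
    (ha' : ∀ i, a i + Pi.single i 1 ∈ A) (hbox : ∀ i, ∀ x ∈ A, ∀ y ∈ A, y i - x i ≤ 1)
    (hpoor : ∀ i, ∀ t : ℝ, ((A.filter fun x => x i = t).card : ℝ) ≤ δ * A.card) :
    ∃ A' ⊆ A, (∀ x ∈ A', ∀ i, a i i ≤ x i ∧ x i < a i i + 1) ∧
      (1 - k * δ) * A.card ≤ A'.card ∧
      ((∃ Y ⊆ A, Y.card ≤ N + 2 * k ∧ (k + 1 + 1 / 14 : ℝ) * A.card ≤ (A + Y).card) ∨
      ∃ (H : AddSubgroup (Fin k → AddCircle (1 : ℝ))) (F : Finset (Fin k → AddCircle (1 : ℝ))),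
        (F : Set (Fin k → AddCircle (1 : ℝ))) = H ∧
        (∀ x ∈ A', ∀ y ∈ A', toTorus k (x - y) ∈ H) ∧ 11 / 12 * (F.card : ℝ) ≤ A.card ∧
        ∀ h ∈ H, 11 / 12 * (A.card : ℝ) ≤
          (A'.image (toTorus k) ∩ (A'.image (toTorus k) + {h})).card) := by
  have hApos : (0 : ℝ) < A.card := by exact_mod_cast hA.card_pos
  have hk' : (1 : ℝ) ≤ k := by exact_mod_cast hk
  have hδ0 : 0 ≤ δ := by
    by_contra! h
    have h1 := hpoor ⟨0, hk⟩ 0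
    have h2 : (0 : ℝ) ≤ (A.filter fun x => x ⟨0, hk⟩ = 0).card := Nat.cast_nonneg _
    nlinarith
  have hkδ : k * δ ≤ 1 / 1000 := by nlinarith [mul_nonneg (by linarith : (0 : ℝ) ≤ k) hδ0]
  set A' := A.filter fun x => ∀ i, x i < a i i + 1 with hA'
  have hA'A : A' ⊆ A := Finset.filter_subset _ _
  have hrange : ∀ x ∈ A, ∀ i, a i i ≤ x i ∧ x i ≤ a i i + 1 := by
    intro x hx i
    have h1 := hbox i _ hx _ (ha' i)
    have h2 := hbox i _ (ha i) _ hx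
    simp only [Pi.add_apply, Pi.single_eq_same] at h1
    constructor <;> linarith
  have hA'box : ∀ x ∈ A', ∀ i, a i i ≤ x i ∧ x i < a i i + 1 := fun x hx i =>
    ⟨(hrange x (hA'A hx) i).1, (Finset.mem_filter.1 hx).2 i⟩
  have hcard : (1 - k * δ) * A.card ≤ A'.card := by
    have h1 : A ⊆ A' ∪ Finset.univ.biUnion fun i => A.filter fun x => x i = a i i + 1 := by
      intro x hx
      by_cases h : ∀ i, x i < a i i + 1
      · exact Finset.mem_union_left _ (Finset.mem_filter.2 ⟨hx, h⟩)
      · push Not at h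
        obtain ⟨i, hi⟩ := h
        refine Finset.mem_union_right _ (Finset.mem_biUnion.2 ⟨i, Finset.mem_univ i, ?_⟩)
        exact Finset.mem_filter.2 ⟨hx, le_antisymm (hrange x hx i).2 hi⟩
    have h2 := ((Finset.card_le_card h1).trans (Finset.card_union_le _ _)).trans
      (Nat.add_le_add_left Finset.card_biUnion_le _)
    have h3 : (A.card : ℝ) ≤ A'.card +
        ∑ i : Fin k, ((A.filter fun x => x i = a i i + 1).card : ℝ) := by exact_mod_cast h2
    have h4 : ∑ i : Fin k, ((A.filter fun x => x i = a i i + 1).card : ℝ) ≤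
        ∑ i : Fin k, δ * A.card := Finset.sum_le_sum fun i _ => hpoor i _
    simp only [Finset.sum_const, Finset.card_univ, Fintype.card_fin, nsmul_eq_mul] at h4
    linarith
  have hA'pos : (0 : ℝ) < A'.card := by nlinarith
  have hA'ne : A'.Nonempty := by
    rw [← Finset.card_pos]
    exact_mod_cast hA'pos
  have hinj : Set.InjOn (toTorus k) A' := fun x hx y hy h =>
    eq_of_toTorus_eq (hA'box x hx) (hA'box y hy) h
  refine ⟨A', hA'A, hA'box, hcard, ?_⟩
  obtain ⟨Y₀, hY₀A, hY₀N, hY₀⟩ := exists_saturated A (C := k + 2) hA hN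
  set Y := Y₀ ∪ (Finset.univ.image a ∪ Finset.univ.image fun i => a i + Pi.single i 1) with hY
  have hYA : Y ⊆ A := by
    refine Finset.union_subset hY₀A (Finset.union_subset ?_ ?_)
    · intro x hx
      obtain ⟨i, -, rfl⟩ := Finset.mem_image.1 hx
      exact ha i
    · intro x hx
      obtain ⟨i, -, rfl⟩ := Finset.mem_image.1 hx
      exact ha' i
  have hYN : Y.card ≤ N + 2 * k := by
    refine (Finset.card_union_le _ _).trans (Nat.add_le_add hY₀N ?_)
    refine (Finset.card_union_le _ _).trans ?_
    have h1 : (Finset.univ.image a).card ≤ k := Finset.card_image_le.trans (by simp)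
    have h2 : (Finset.univ.image fun i => a i + Pi.single i 1).card ≤ k :=
      Finset.card_image_le.trans (by simp)
    omega
  have hmono : A + Y₀ ⊆ A + Y := Finset.add_subset_add_left Finset.subset_union_left
  rcases hY₀ with hY₀ | hY₀
  · left
    refine ⟨Y, hYA, hYN, ?_⟩
    have h1 : ((A + Y₀).card : ℝ) ≤ (A + Y).card := by exact_mod_cast Finset.card_le_card hmono
    nlinarith
  set S := A + Y with hS
  have hchain : k * A'.card + (S.image (toTorus k)).card ≤ S.card := by
    refine mul_card_add_card_image_toTorus_le a hinj (fun i x hx => ?_) (fun i x hx => ?_)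
    · refine Finset.add_mem_add (hA'A hx) ?_
      simp [hY]
    · rw [add_assoc]
      refine Finset.add_mem_add (hA'A hx) ?_
      simp [hY]
  have hchain' : (k : ℝ) * A'.card + (S.image (toTorus k)).card ≤ S.card := by
    exact_mod_cast hchain
  by_cases hlarge : (1 + 1 / 13 : ℝ) * A.card ≤ (S.image (toTorus k)).card
  · left
    refine ⟨Y, hYA, hYN, ?_⟩
    have h1 : (k : ℝ) * ((1 - k * δ) * A.card) ≤ k * A'.card :=
      mul_le_mul_of_nonneg_left hcard (by linarith)
    have h2 : k * (k * δ) * A.card ≤ 1 / 1000 * A.card := mul_le_mul_of_nonneg_right hδ hApos.le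
    nlinarith
  · right
    push Not at hlarge
    set B := A'.image (toTorus k) with hB
    have hBcard : B.card = A'.card := Finset.card_image_of_injOn hinj
    have hout : ∀ b ∈ A, (((B + {toTorus k b}) \ S.image (toTorus k)).card : ℝ) ≤
        1 / 1000 * A.card := by
      intro b hb
      refine le_trans ?_ (hY₀ b hb)
      have h1 : (B + {toTorus k b}) \ S.image (toTorus k) ⊆
          ((A + {b}) \ (A + Y₀)).image (toTorus k) := by
        intro x hx
        rw [Finset.mem_sdiff, Finset.mem_add] at hx
        obtain ⟨⟨y, hy, z, hz, rfl⟩, hxS⟩ := hx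
        rw [Finset.mem_singleton] at hz
        obtain ⟨u, hu, rfl⟩ := Finset.mem_image.1 hy
        rw [hz, ← map_add] at hxS ⊢
        refine Finset.mem_image_of_mem _ (Finset.mem_sdiff.2
          ⟨Finset.add_mem_add (hA'A hu) (Finset.mem_singleton_self b), fun h => hxS ?_⟩)
        exact Finset.mem_image_of_mem _ (hmono h)
      exact_mod_cast (Finset.card_le_card h1).trans Finset.card_image_le
    have hinter : ∀ x ∈ B, ∀ y ∈ B, 11 / 12 * (A.card : ℝ) ≤ ((B + {x}) ∩ (B + {y})).card := by
      intro x hx y hy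
      obtain ⟨u, hu, rfl⟩ := Finset.mem_image.1 hx
      obtain ⟨v, hv, rfl⟩ := Finset.mem_image.1 hy
      have h1 := hout u (hA'A hu)
      have h2 := hout v (hA'A hv)
      have h3 : ((B + {toTorus k u}) ∪ (B + {toTorus k v})) ⊆ S.image (toTorus k) ∪
          (((B + {toTorus k u}) \ S.image (toTorus k)) ∪
            ((B + {toTorus k v}) \ S.image (toTorus k))) := by
        intro z hz
        simp only [Finset.mem_union, Finset.mem_sdiff] at hz ⊢
        tauto
      have h4 := (Finset.card_le_card h3).trans ((Finset.card_union_le _ _).trans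
        (Nat.add_le_add_left (Finset.card_union_le _ _) _))
      have h5 := Finset.card_union_add_card_inter (B + {toTorus k u}) (B + {toTorus k v})
      rw [Finset.card_add_singleton, Finset.card_add_singleton, hBcard] at h5
      have h4' : (((B + {toTorus k u}) ∪ (B + {toTorus k v})).card : ℝ) ≤
          (S.image (toTorus k)).card + (((B + {toTorus k u}) \ S.image (toTorus k)).card +
            ((B + {toTorus k v}) \ S.image (toTorus k)).card) := by exact_mod_cast h4
      have h5' : (((B + {toTorus k u}) ∪ (B + {toTorus k v})).card : ℝ) +
          ((B + {toTorus k u}) ∩ (B + {toTorus k v})).card = A'.card + A'.card := by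
        exact_mod_cast h5
      nlinarith
    have hBN : (B.card : ℝ) ≤ A.card := by
      rw [hBcard]
      exact_mod_cast Finset.card_le_card hA'A
    obtain ⟨H, F, hFH, hBH, hF, hH⟩ :=
      exists_addSubgroup_of_large_inter (hA'ne.image _) hBN hinter
    refine ⟨H, F, hFH, fun x hx y hy => ?_, hF, hH⟩
    rw [map_sub]
    exact hBH _ (Finset.mem_image_of_mem _ hx) _ (Finset.mem_image_of_mem _ hy)

/-- The representative of a torus point in the half-open unit box based at `c`. -/
noncomputable def torusRep {k : ℕ} (c : Fin k → ℝ) (z : Fin k → AddCircle (1 : ℝ)) : Fin k → ℝ :=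
  fun i => (AddCircle.equivIco 1 (c i) (z i) : ℝ)

theorem torusRep_mem {k : ℕ} (c : Fin k → ℝ) (z : Fin k → AddCircle (1 : ℝ)) (i : Fin k) :
    c i ≤ torusRep c z i ∧ torusRep c z i < c i + 1 :=
  (AddCircle.equivIco 1 (c i) (z i)).2

theorem toTorus_torusRep {k : ℕ} (c : Fin k → ℝ) (z : Fin k → AddCircle (1 : ℝ)) :
    toTorus k (torusRep c z) = z := by
  ext i
  exact (AddCircle.coe_equivIco (p := (1 : ℝ)) (a := c i))

theorem torusRep_toTorus_apply {k : ℕ} {c x : Fin k → ℝ} {i : Fin k}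
    (hx : c i ≤ x i ∧ x i < c i + 1) : torusRep c (toTorus k x) i = x i := by
  obtain ⟨n, hn⟩ := exists_int_of_toTorus_eq (toTorus_torusRep c (toTorus k x)) i
  have h := torusRep_mem c (toTorus k x) i
  have h1 : (n : ℝ) < 1 := by linarith [h.1, hx.2]
  have h2 : (-1 : ℝ) < n := by linarith [h.2, hx.1]
  have h3 : n < 1 := by exact_mod_cast h1
  have h4 : -1 < n := by exact_mod_cast h2
  have h5 : n = 0 := by omega
  simp [hn, h5]

theorem exists_torus_cell {k : ℕ} (i₀ i₁ : Fin k) (c : Fin k → ℝ)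
    (F : Finset (Fin k → AddCircle (1 : ℝ))) {N : ℕ} (hN : 0 < N) :
    ∃ p q : ℕ, p < N ∧ q < N ∧ (F.card : ℝ) / N ^ 2 ≤ (F.filter fun z =>
      (c i₀ + p / N ≤ torusRep c z i₀ ∧ torusRep c z i₀ < c i₀ + (p + 1) / N) ∧
      (c i₁ + q / N ≤ torusRep c z i₁ ∧ torusRep c z i₁ < c i₁ + (q + 1) / N)).card := by
  have hN' : (0 : ℝ) < N := by exact_mod_cast hN
  have hfl : ∀ z i, ⌊N * (torusRep c z i - c i)⌋₊ < N := by
    intro z i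
    have h := torusRep_mem c z i
    rw [Nat.floor_lt (mul_nonneg hN'.le (by linarith))]
    nlinarith
  have hfl' : ∀ z i p, ⌊N * (torusRep c z i - c i)⌋₊ = p →
      c i + p / N ≤ torusRep c z i ∧ torusRep c z i < c i + (p + 1) / N := by
    rintro z i p rfl
    have h := torusRep_mem c z i
    have h1 := Nat.floor_le (mul_nonneg hN'.le (by linarith : 0 ≤ torusRep c z i - c i))
    have h2 := Nat.lt_floor_add_one (N * (torusRep c z i - c i))
    constructor
    · rw [← le_sub_iff_add_le', div_le_iff₀ hN']; linarith
    · rw [← sub_lt_iff_lt_add', lt_div_iff₀ hN']; linarith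
  obtain ⟨⟨p, q⟩, hpq, hcard⟩ := Finset.exists_le_card_fiber_of_nsmul_le_card_of_maps_to
    (s := F) (t := Finset.range N ×ˢ Finset.range N) (b := (F.card : ℝ) / N ^ 2)
    (f := fun z => (⌊N * (torusRep c z i₀ - c i₀)⌋₊, ⌊N * (torusRep c z i₁ - c i₁)⌋₊))
    (fun z _ => Finset.mem_product.2 ⟨Finset.mem_range.2 (hfl z i₀), Finset.mem_range.2 (hfl z i₁)⟩)
    ⟨(0, 0), by simp [hN]⟩ (by
      rw [Finset.card_product, Finset.card_range, nsmul_eq_mul]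
      push_cast
      rw [← sq, mul_div_cancel₀ _ (by positivity)])
  rw [Finset.mem_product, Finset.mem_range, Finset.mem_range] at hpq
  refine ⟨p, q, hpq.1, hpq.2, hcard.trans ?_⟩
  rw [Nat.cast_le]
  refine Finset.card_le_card (Finset.monotone_filter_right _ fun z _ hz => ?_)
  rw [Prod.mk.injEq] at hz
  exact ⟨hfl' z i₀ p hz.1, hfl' z i₁ q hz.2⟩

theorem exists_small_independent {k : ℕ} {i₀ i₁ : Fin k} (hi : i₀ ≠ i₁) {δ : ℝ}
    (hδ : δ ≤ 1 / 10 ^ 11) {A A' : Finset (Fin k → ℝ)} {c : Fin k → ℝ} (hA : A.Nonempty)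
    (hA'A : A' ⊆ A) (hcard : 999 / 1000 * (A.card : ℝ) ≤ A'.card)
    (hbox : ∀ x ∈ A', ∀ i, c i ≤ x i ∧ x i < c i + 1)
    (hpoor : ∀ φ : (Fin k → ℝ) →ₗ[ℝ] ℝ, φ ≠ 0 → ∀ t : ℝ,
      ((A.filter fun x => φ x = t).card : ℝ) ≤ δ * A.card)
    {H : AddSubgroup (Fin k → AddCircle (1 : ℝ))} {F : Finset (Fin k → AddCircle (1 : ℝ))}
    (hF : (F : Set (Fin k → AddCircle (1 : ℝ))) = H)
    (hA'F : A'.card ≤ F.card)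
    (hH : ∀ h ∈ H, 11 / 12 * (A.card : ℝ) ≤
      (A'.image (toTorus k) ∩ (A'.image (toTorus k) + {h})).card) :
    ∃ γ γ' : Fin k → ℝ, toTorus k γ ∈ H ∧ toTorus k γ' ∈ H ∧
      (|γ i₀| < 1 / 40400 ∧ |γ i₁| < 1 / 40400) ∧ (|γ' i₀| < 1 / 40400 ∧ |γ' i₁| < 1 / 40400) ∧
      γ i₀ * γ' i₁ - γ i₁ * γ' i₀ ≠ 0 := by
  have hApos : (0 : ℝ) < A.card := by exact_mod_cast hA.card_pos
  have hA'pos : (0 : ℝ) < A'.card := by linarith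
  have hA'ne : A'.Nonempty := by
    rw [← Finset.card_pos]
    exact_mod_cast hA'pos
  have hA'F' : (A'.card : ℝ) ≤ F.card := by exact_mod_cast hA'F
  have hmemF : ∀ h, h ∈ F ↔ h ∈ H := fun h => by rw [← Finset.mem_coe, hF]; rfl
  have hinj : Set.InjOn (toTorus k) A' := fun x hx y hy h =>
    eq_of_toTorus_eq (hbox x hx) (hbox y hy) h
  obtain ⟨p, q, -, -, hcell⟩ := exists_torus_cell i₀ i₁ (0 : Fin k → ℝ) F (N := 40400) (by norm_num)
  set F₁ := F.filter fun z => ((0 : Fin k → ℝ) i₀ + p / (40400 : ℕ) ≤ torusRep 0 z i₀ ∧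
    torusRep 0 z i₀ < (0 : Fin k → ℝ) i₀ + (p + 1) / (40400 : ℕ)) ∧
    ((0 : Fin k → ℝ) i₁ + q / (40400 : ℕ) ≤ torusRep 0 z i₁ ∧
    torusRep 0 z i₁ < (0 : Fin k → ℝ) i₁ + (q + 1) / (40400 : ℕ)) with hF₁
  push_cast at hcell
  have hF₁pos : (0 : ℝ) < F₁.card := by
    refine lt_of_lt_of_le ?_ hcell
    have : (0 : ℝ) < F.card := by linarith
    positivity
  obtain ⟨g₀, hg₀⟩ : F₁.Nonempty := by
    rw [← Finset.card_pos]
    exact_mod_cast hF₁pos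
  set γ : (Fin k → AddCircle (1 : ℝ)) → Fin k → ℝ := fun g => torusRep 0 g - torusRep 0 g₀ with hγ
  have hγq : ∀ g, toTorus k (γ g) = g - g₀ := fun g => by
    rw [hγ, map_sub, toTorus_torusRep, toTorus_torusRep]
  have hγH : ∀ g ∈ F₁, g - g₀ ∈ H := fun g hg => H.sub_mem
    ((hmemF _).1 (Finset.mem_filter.1 hg).1) ((hmemF _).1 (Finset.mem_filter.1 hg₀).1)
  have hγs : ∀ g ∈ F₁, |γ g i₀| < 1 / 40400 ∧ |γ g i₁| < 1 / 40400 := by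
    intro g hg
    have h1 := (Finset.mem_filter.1 hg).2
    have h2 := (Finset.mem_filter.1 hg₀).2
    push_cast at h1 h2
    simp only [add_div] at h1 h2
    constructor <;> rw [abs_lt] <;> simp only [hγ, Pi.sub_apply] <;> constructor <;> linarith
  by_contra! hcon
  have hcol : ∀ g ∈ F₁, ∀ g' ∈ F₁, γ g i₀ * γ g' i₁ - γ g i₁ * γ g' i₀ = 0 :=
    fun g hg g' hg' => hcon _ _ (by rw [hγq]; exact hγH g hg) (by rw [hγq]; exact hγH g' hg')
      (hγs g hg) (hγs g' hg')
  obtain ⟨α, β, hαβ, hker⟩ : ∃ α β : ℝ, (α ≠ 0 ∨ β ≠ 0) ∧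
      ∀ g ∈ F₁, α * γ g i₀ + β * γ g i₁ = 0 := by
    by_cases h : ∀ g ∈ F₁, γ g i₀ = 0
    · exact ⟨1, 0, Or.inl one_ne_zero, fun g hg => by rw [h g hg]; ring⟩
    · push Not at h
      obtain ⟨g', hg', h⟩ := h
      exact ⟨-γ g' i₁, γ g' i₀, Or.inr h, fun g hg => by linarith [hcol g hg g' hg']⟩
  set φ : (Fin k → ℝ) →ₗ[ℝ] ℝ := α • LinearMap.proj i₀ + β • LinearMap.proj i₁ with hφ
  have hφa : ∀ x, φ x = α * x i₀ + β * x i₁ := fun x => by simp [hφ]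
  have hφ0 : φ ≠ 0 := by
    intro h
    rcases hαβ with h1 | h1
    · have h2 := hφa (Pi.single i₀ 1)
      rw [h] at h2
      simp [hi.symm] at h2
      exact h1 h2.symm
    · have h2 := hφa (Pi.single i₁ 1)
      rw [h] at h2
      simp [hi] at h2
      exact h1 h2.symm
  set B := A'.image (toTorus k) with hB
  have hBcard : B.card = A'.card := Finset.card_image_of_injOn hinj
  set G₀ := F₁.image (· - g₀) with hG₀
  have hG₀card : G₀.card = F₁.card :=
    Finset.card_image_of_injective _ (sub_left_injective)
  obtain ⟨a, ha, hab⟩ := exists_card_filter_notMem_le (A := B) (B := G₀) (S := B) (ε := 1 / 10)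
    (hA'ne.image _) (fun b hb => by
      obtain ⟨g, hg, rfl⟩ := Finset.mem_image.1 hb
      have h1 := hH _ (hγH g hg)
      have h2 := Finset.card_sdiff_add_card_inter (B + {g - g₀}) B
      rw [Finset.card_add_singleton, Finset.inter_comm, hBcard] at h2
      have h2' : (((B + {g - g₀}) \ B).card : ℝ) + (B ∩ (B + {g - g₀})).card = A'.card := by
        exact_mod_cast h2
      have h3 : (A'.card : ℝ) ≤ A.card := by exact_mod_cast Finset.card_le_card hA'A
      rw [hBcard]
      linarith)
  obtain ⟨x, hx, rfl⟩ := Finset.mem_image.1 ha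
  have hsplit := Finset.card_filter_add_card_filter_not (s := G₀) (fun b => toTorus k x + b ∈ B)
  have hsub : (G₀.filter fun b => toTorus k x + b ∈ B) ⊆
      (A'.filter fun y => toTorus k y - toTorus k x ∈ G₀).image fun y =>
        toTorus k y - toTorus k x := by
    intro b hb
    rw [Finset.mem_filter] at hb
    obtain ⟨y, hy, hyb⟩ := Finset.mem_image.1 hb.2
    have h1 : toTorus k y - toTorus k x = b := by rw [hyb]; abel
    exact Finset.mem_image.2 ⟨y, Finset.mem_filter.2 ⟨hy, h1 ▸ hb.1⟩, h1⟩
  have hsub' : (A'.filter fun y => toTorus k y - toTorus k x ∈ G₀) ⊆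
      (Finset.Icc (-1 : ℤ) 1 ×ˢ Finset.Icc (-1 : ℤ) 1).biUnion fun n =>
        A.filter fun y => φ y = φ x + α * n.1 + β * n.2 := by
    intro y hy
    rw [Finset.mem_filter] at hy
    obtain ⟨g, hg, hgy⟩ := Finset.mem_image.1 hy.2
    have h1 : toTorus k (x + γ g) = toTorus k y := by
      rw [map_add, hγq, hgy]; abel
    have hint : ∀ i, |γ g i| < 1 / 40400 → ∃ n : ℤ, n ∈ Finset.Icc (-1 : ℤ) 1 ∧
        y i = x i + γ g i + n := by
      intro i hγi
      obtain ⟨n, hn⟩ := exists_int_of_toTorus_eq h1 i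
      rw [Pi.add_apply] at hn
      rw [abs_lt] at hγi
      have h2 := hbox x hx i
      have h3 := hbox y hy.1 i
      have h4 : (n : ℝ) < 2 := by linarith [h2.1, h3.2, hγi.1]
      have h5 : (-2 : ℝ) < n := by linarith [h2.2, h3.1, hγi.2]
      have h6 : n < 2 := by exact_mod_cast h4
      have h7 : -2 < n := by exact_mod_cast h5
      exact ⟨n, Finset.mem_Icc.2 ⟨by omega, by omega⟩, hn⟩
    obtain ⟨n₀, hn₀, hy₀⟩ := hint i₀ (hγs g hg).1
    obtain ⟨n₁, hn₁, hy₁⟩ := hint i₁ (hγs g hg).2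
    refine Finset.mem_biUnion.2 ⟨(n₀, n₁), Finset.mem_product.2 ⟨hn₀, hn₁⟩,
      Finset.mem_filter.2 ⟨hA'A hy.1, ?_⟩⟩
    rw [hφa, hφa, hy₀, hy₁]
    linarith [hker g hg]
  have hle : (((G₀.filter fun b => toTorus k x + b ∈ B).card : ℕ) : ℝ) ≤
      ∑ n ∈ Finset.Icc (-1 : ℤ) 1 ×ˢ Finset.Icc (-1 : ℤ) 1,
        ((A.filter fun y => φ y = φ x + α * n.1 + β * n.2).card : ℝ) := by
    exact_mod_cast (Finset.card_le_card hsub).trans (Finset.card_image_le.trans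
      ((Finset.card_le_card hsub').trans Finset.card_biUnion_le))
  have hle' := hle.trans (Finset.sum_le_sum fun n _ => hpoor φ hφ0 _)
  have h9 : (Finset.Icc (-1 : ℤ) 1 ×ˢ Finset.Icc (-1 : ℤ) 1).card = 9 := by decide
  rw [Finset.sum_const, h9, nsmul_eq_mul] at hle'
  have hsplit' : ((G₀.filter fun b => toTorus k x + b ∈ B).card : ℝ) +
      (G₀.filter fun b => toTorus k x + b ∉ B).card = F₁.card := by
    rw [← hG₀card]; exact_mod_cast hsplit
  rw [hG₀card] at hab
  have h10 : δ * A.card ≤ 1 / 10 ^ 11 * A.card := mul_le_mul_of_nonneg_right hδ hApos.le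
  have h11 : (F.card : ℝ) / 40400 ^ 2 ≤ F₁.card := hcell
  push_cast at hle'
  norm_num at h10 h11
  linarith

theorem exists_mem_near {k : ℕ} {i₀ i₁ : Fin k} {H : AddSubgroup (Fin k → AddCircle (1 : ℝ))}
    {γ γ' : Fin k → ℝ} {τ : ℝ} (h : toTorus k γ ∈ H) (h' : toTorus k γ' ∈ H)
    (hγ : |γ i₀| < τ ∧ |γ i₁| < τ) (hγ' : |γ' i₀| < τ ∧ |γ' i₁| < τ)
    (hdet : γ i₀ * γ' i₁ - γ i₁ * γ' i₀ ≠ 0) (u v : ℝ) :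
    ∃ x : Fin k → ℝ, toTorus k x ∈ H ∧ |x i₀ - u| ≤ 2 * τ ∧ |x i₁ - v| ≤ 2 * τ := by
  set D := γ i₀ * γ' i₁ - γ i₁ * γ' i₀ with hD
  set s := (u * γ' i₁ - v * γ' i₀) / D with hs
  set t := (γ i₀ * v - γ i₁ * u) / D with ht
  have hsD : s * D = u * γ' i₁ - v * γ' i₀ := div_mul_cancel₀ _ hdet
  have htD : t * D = γ i₀ * v - γ i₁ * u := div_mul_cancel₀ _ hdet
  have hu : u = s * γ i₀ + t * γ' i₀ := by
    refine mul_right_cancel₀ hdet ?_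
    linear_combination (-γ i₀) * hsD - γ' i₀ * htD + u * hD
  have hv : v = s * γ i₁ + t * γ' i₁ := by
    refine mul_right_cancel₀ hdet ?_
    linear_combination (-γ i₁) * hsD - γ' i₁ * htD + v * hD
  have hfr : ∀ r y : ℝ, |y| < τ → |(⌊r⌋ : ℝ) * y - r * y| ≤ τ := by
    intro r y hy
    rw [← sub_mul, abs_mul]
    have h1 : |(⌊r⌋ : ℝ) - r| ≤ 1 := by
      rw [abs_le]
      constructor <;> linarith [Int.floor_le r, Int.lt_floor_add_one r]
    nlinarith [abs_nonneg y]
  refine ⟨⌊s⌋ • γ + ⌊t⌋ • γ', ?_, ?_, ?_⟩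
  · rw [map_add, map_zsmul, map_zsmul]
    exact H.add_mem (H.zsmul_mem h _) (H.zsmul_mem h' _)
  · have h1 := abs_le.1 (hfr s _ hγ.1)
    have h2 := abs_le.1 (hfr t _ hγ'.1)
    simp only [Pi.add_apply, Pi.smul_apply]
    rw [zsmul_eq_mul, zsmul_eq_mul, abs_le]
    constructor <;> linarith
  · have h1 := abs_le.1 (hfr s _ hγ.2)
    have h2 := abs_le.1 (hfr t _ hγ'.2)
    simp only [Pi.add_apply, Pi.smul_apply]
    rw [zsmul_eq_mul, zsmul_eq_mul, abs_le]
    constructor <;> linarith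

/-- Membership in the cell indexed by `n` of the grid of mesh `1 / 100` based at `c`, in the
coordinates `i₀` and `i₁`. -/
def gridBox {k : ℕ} (i₀ i₁ : Fin k) (c : Fin k → ℝ) (n : ℕ × ℕ) (x : Fin k → ℝ) : Prop :=
  (c i₀ + n.1 / 100 ≤ x i₀ ∧ x i₀ < c i₀ + (n.1 + 1) / 100) ∧
    (c i₁ + n.2 / 100 ≤ x i₁ ∧ x i₁ < c i₁ + (n.2 + 1) / 100)

theorem gridBox_unique {k : ℕ} {i₀ i₁ : Fin k} {c x : Fin k → ℝ} {m n : ℕ × ℕ}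
    (hm : gridBox i₀ i₁ c m x) (hn : gridBox i₀ i₁ c n x) : m = n := by
  have key : ∀ (a b : ℕ) (s y : ℝ), s + (a : ℝ) / 100 ≤ y → y < s + ((b : ℝ) + 1) / 100 → a ≤ b := by
    intro a b s y h1 h2
    have : (a : ℝ) < b + 1 := by linarith
    exact Nat.lt_succ_iff.1 (by exact_mod_cast this)
  exact Prod.ext (le_antisymm (key _ _ _ _ hm.1.1 hn.1.2) (key _ _ _ _ hn.1.1 hm.1.2))
    (le_antisymm (key _ _ _ _ hm.2.1 hn.2.2) (key _ _ _ _ hn.2.1 hm.2.2))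

theorem card_missed_boxes_le {k : ℕ} {i₀ i₁ : Fin k} {A' : Finset (Fin k → ℝ)} {c x₀ : Fin k → ℝ}
    {H : AddSubgroup (Fin k → AddCircle (1 : ℝ))} {F : Finset (Fin k → AddCircle (1 : ℝ))}
    (hbox : ∀ x ∈ A', ∀ i, c i ≤ x i ∧ x i < c i + 1)
    (hF : (F : Set (Fin k → AddCircle (1 : ℝ))) = H) (hx₀ : x₀ ∈ A')
    (hA'H : ∀ x ∈ A', ∀ y ∈ A', toTorus k (x - y) ∈ H)
    (hnear : ∀ u v : ℝ, ∃ x : Fin k → ℝ, toTorus k x ∈ H ∧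
      |x i₀ - u| ≤ 1 / 20200 ∧ |x i₁ - v| ≤ 1 / 20200)
    {E : Finset (ℕ × ℕ)} (hE : ∀ n ∈ E, n.1 < 100 ∧ n.2 < 100)
    (hE' : ∀ n ∈ E, ∀ x ∈ A', ¬ gridBox i₀ i₁ c n x) :
    (E.card : ℝ) * ((F.card : ℝ) / 101 ^ 2) + A'.card ≤ F.card := by
  have hmemF : ∀ h, h ∈ F ↔ h ∈ H := fun h => by rw [← Finset.mem_coe, hF]; rfl
  set B := A'.image (toTorus k) with hB
  have hBcard : B.card = A'.card := Finset.card_image_of_injOn fun x hx y hy h =>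
    eq_of_toTorus_eq (hbox x hx) (hbox y hy) h
  set Z := F + {toTorus k x₀} with hZ
  have hZcard : Z.card = F.card := Finset.card_add_singleton _ _
  have hBZ : B ⊆ Z := by
    intro b hb
    obtain ⟨x, hx, rfl⟩ := Finset.mem_image.1 hb
    rw [hZ, mem_add_singleton_iff, hmemF, ← map_sub]
    exact hA'H x hx x₀ hx₀
  obtain ⟨p, q, -, -, hcell⟩ := exists_torus_cell i₀ i₁ c Z (N := 101) (by norm_num)
  rw [hZcard] at hcell
  push_cast at hcell
  have hlarge : ∀ n ∈ E,
      (F.card : ℝ) / 101 ^ 2 ≤ (Z.filter fun z => gridBox i₀ i₁ c n (torusRep c z)).card := by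
    rintro ⟨a, b⟩ hab
    replace hab := hE _ hab
    have ha : (a : ℝ) + 1 ≤ 100 := by exact_mod_cast hab.1
    have hb : (b : ℝ) + 1 ≤ 100 := by exact_mod_cast hab.2
    have ha0 : (0 : ℝ) ≤ a := a.cast_nonneg
    have hb0 : (0 : ℝ) ≤ b := b.cast_nonneg
    obtain ⟨γ, hγ, hγ₀, hγ₁⟩ := hnear ((a : ℝ) / 100 + 1 / 20200 - p / 101)
      ((b : ℝ) / 100 + 1 / 20200 - q / 101)
    rw [abs_le] at hγ₀ hγ₁
    refine hcell.trans ?_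
    rw [Nat.cast_le]
    refine Finset.card_le_card_of_injOn (fun z => z + toTorus k γ) ?_
      (add_left_injective _).injOn
    intro z hz
    obtain ⟨hzZ, ⟨h1, h2⟩, h3, h4⟩ := Finset.mem_filter.1 (Finset.mem_coe.1 hz)
    have hz' : z + toTorus k γ = toTorus k (torusRep c z + γ) := by
      rw [map_add, toTorus_torusRep]
    have hr : ∀ i, c i ≤ torusRep c z i + γ i ∧ torusRep c z i + γ i < c i + 1 →
        torusRep c (z + toTorus k γ) i = torusRep c z i + γ i := fun i hi => by
      rw [hz', torusRep_toTorus_apply (x := torusRep c z + γ) hi, Pi.add_apply]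
    refine Finset.mem_coe.2 (Finset.mem_filter.2 ⟨?_, ?_⟩)
    · rw [hZ, mem_add_singleton_iff, hmemF] at hzZ ⊢
      rw [add_sub_right_comm]
      exact H.add_mem hzZ hγ
    · unfold gridBox
      rw [hr i₀ ⟨by linarith, by linarith⟩, hr i₁ ⟨by linarith, by linarith⟩]
      dsimp only
      exact ⟨⟨by linarith, by linarith⟩, by linarith, by linarith⟩
  have hU : (E.biUnion fun n => Z.filter fun z => gridBox i₀ i₁ c n (torusRep c z)) ⊆ Z \ B := by
    intro z hz
    obtain ⟨n, hn, hzn⟩ := Finset.mem_biUnion.1 hz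
    rw [Finset.mem_filter] at hzn
    refine Finset.mem_sdiff.2 ⟨hzn.1, fun hzB => ?_⟩
    obtain ⟨x, hx, rfl⟩ := Finset.mem_image.1 hzB
    have h1 : torusRep c (toTorus k x) = x := funext fun i => torusRep_toTorus_apply (hbox x hx i)
    have h2 := hzn.2
    rw [h1] at h2
    exact hE' n hn x hx h2
  have hcardU := Finset.card_le_card hU
  have hdisj : ∀ m ∈ E, ∀ n ∈ E, m ≠ n →
      Disjoint (Z.filter fun z => gridBox i₀ i₁ c m (torusRep c z))
        (Z.filter fun z => gridBox i₀ i₁ c n (torusRep c z)) := fun m _ n _ hmn =>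
    Finset.disjoint_left.2 fun z hz hz' =>
      hmn (gridBox_unique (Finset.mem_filter.1 hz).2 (Finset.mem_filter.1 hz').2)
  rw [Finset.card_biUnion hdisj] at hcardU
  have h1 := Finset.card_sdiff_add_card_eq_card hBZ
  rw [hBcard, hZcard] at h1
  have h2 : (E.card : ℝ) * ((F.card : ℝ) / 101 ^ 2) ≤ ((Z \ B).card : ℕ) := by
    refine le_trans ?_ (Nat.cast_le.2 hcardU)
    rw [← nsmul_eq_mul, Nat.cast_sum]
    exact Finset.card_nsmul_le_sum _ _ _ fun n hn => hlarge n hn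
  have h3 : ((Z \ B).card : ℝ) + A'.card = F.card := by exact_mod_cast h1
  linarith

theorem false_of_near_corners {k : ℕ} {i₀ i₁ : Fin k} (hi : i₀ ≠ i₁) {A' : Finset (Fin k → ℝ)}
    {c : Fin k → ℝ} {E : Finset (ℕ × ℕ)} (hE : E.card ≤ 1020)
    (hbox : ∀ i, ∀ x ∈ A', ∀ y ∈ A', y i - x i ≤ 1)
    (hdet : ∀ i j, i ≠ j → ∀ a ∈ A', ∀ b ∈ A', ∀ a' ∈ A', ∀ b' ∈ A',
      (b - a) i * (b' - a') j - (b - a) j * (b' - a') i ≤ 1)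
    (hhit : ∀ a b, a < 100 → b < 100 → (a, b) ∉ E → ∃ x ∈ A', gridBox i₀ i₁ c (a, b) x) :
    False := by
  obtain ⟨a₁, b₁, a₂, b₂, a₃, b₃, a₄, b₄, ha₁, hb₁, ha₂, hb₂, ha₃, hb₃, ha₄, hb₄, h₁, h₂, h₃, h₄,
    hsum⟩ := exists_notMem_four_corners hE
  obtain ⟨x₁, hx₁, ⟨h11, h12⟩, h13, h14⟩ := hhit _ _ (by omega) (by omega) h₁
  obtain ⟨x₂, hx₂, ⟨h21, h22⟩, h23, h24⟩ := hhit _ _ (by omega) (by omega) h₂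
  obtain ⟨x₃, hx₃, ⟨h31, h32⟩, h33, h34⟩ := hhit _ _ (by omega) (by omega) h₃
  obtain ⟨x₄, hx₄, ⟨h41, h42⟩, h43, h44⟩ := hhit _ _ (by omega) (by omega) h₄
  dsimp only at *
  have hcast : ∀ a : ℕ, a < 50 → ((99 - a : ℕ) : ℝ) = 99 - a := fun a ha => by
    rw [Nat.cast_sub (by omega)]; norm_num
  rw [hcast _ ha₂] at h21 h22
  rw [hcast _ hb₂] at h23 h24
  rw [hcast _ ha₃] at h31 h32
  rw [hcast _ hb₄] at h43 h44
  have hsum' : (a₁ + b₁ + a₂ + b₂ + a₃ + b₃ + a₄ + b₄ : ℝ) < 92 := by exact_mod_cast hsum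
  have ha₁' : (a₁ : ℝ) < 50 := by exact_mod_cast ha₁
  have ha₂' : (a₂ : ℝ) < 50 := by exact_mod_cast ha₂
  have ha₃' : (a₃ : ℝ) < 50 := by exact_mod_cast ha₃
  have ha₄' : (a₄ : ℝ) < 50 := by exact_mod_cast ha₄
  have hb₁' : (b₁ : ℝ) < 50 := by exact_mod_cast hb₁
  have hb₂' : (b₂ : ℝ) < 50 := by exact_mod_cast hb₂
  have hb₃' : (b₃ : ℝ) < 50 := by exact_mod_cast hb₃
  have hb₄' : (b₄ : ℝ) < 50 := by exact_mod_cast hb₄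
  have hd := hdet i₀ i₁ hi x₁ hx₁ x₂ hx₂ x₃ hx₃ x₄ hx₄
  simp only [Pi.sub_apply] at hd
  have u1 := hbox i₀ x₁ hx₁ x₂ hx₂
  have u2 := hbox i₁ x₁ hx₁ x₂ hx₂
  have u3 := hbox i₀ x₄ hx₄ x₃ hx₃
  have u4 := hbox i₁ x₃ hx₃ x₄ hx₄
  set α := x₂ i₀ - x₁ i₀
  set β := x₂ i₁ - x₁ i₁
  set κ := x₄ i₁ - x₃ i₁
  obtain ⟨γ, hγ⟩ : ∃ γ, γ = x₃ i₀ - x₄ i₀ := ⟨_, rfl⟩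
  have hγ' : x₄ i₀ - x₃ i₀ = -γ := by rw [hγ]; ring
  rw [hγ'] at hd
  rw [← hγ] at u3
  have l1 : 1 - (a₁ + a₂ + 2) / 100 ≤ α := by simp only [α]; linarith
  have l2 : 1 - (b₁ + b₂ + 2) / 100 ≤ β := by simp only [β]; linarith
  have l3 : 1 - (a₃ + a₄ + 2) / 100 ≤ γ := by rw [hγ]; linarith
  have l4 : 1 - (b₃ + b₄ + 2) / 100 ≤ κ := by simp only [κ]; linarith
  nlinarith [mul_nonneg (sub_nonneg.2 u1) (sub_nonneg.2 u4),
    mul_nonneg (sub_nonneg.2 u2) (sub_nonneg.2 u3)]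

theorem exists_card_add_ge_of_normalized {k N : ℕ} (hk : 2 ≤ k) {δ : ℝ}
    (hδ : δ ≤ 1 / 10 ^ 11) (hδk : k * (k * δ) ≤ 1 / 1000) (hN : (k + 2 : ℝ) < N * (1 / 1000))
    {A : Finset (Fin k → ℝ)} (hA : A.Nonempty)
    (hedge : ∀ i, ∃ a ∈ A, a + Pi.single i 1 ∈ A)
    (hbox : ∀ i, ∀ x ∈ A, ∀ y ∈ A, y i - x i ≤ 1)
    (hdet : ∀ i j, i ≠ j → ∀ a ∈ A, ∀ b ∈ A, ∀ a' ∈ A, ∀ b' ∈ A,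
      (b - a) i * (b' - a') j - (b - a) j * (b' - a') i ≤ 1)
    (hpoor : ∀ φ : (Fin k → ℝ) →ₗ[ℝ] ℝ, φ ≠ 0 → ∀ t : ℝ,
      ((A.filter fun x => φ x = t).card : ℝ) ≤ δ * A.card) :
    ∃ Y ⊆ A, Y.card ≤ N + 2 * k ∧ (k + 1 + 1 / 14 : ℝ) * A.card ≤ (A + Y).card := by
  choose a ha ha' using hedge
  have hApos : (0 : ℝ) < A.card := by exact_mod_cast hA.card_pos
  have hk' : (2 : ℝ) ≤ k := by exact_mod_cast hk
  have hcoord : ∀ (i : Fin k) (t : ℝ), ((A.filter fun x => x i = t).card : ℝ) ≤ δ * A.card := by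
    intro i t
    refine hpoor (LinearMap.proj i) (fun h => ?_) t
    have h1 := LinearMap.congr_fun h (Pi.single i 1)
    simp at h1
  obtain ⟨A', hA'A, hbox', hcard, h | ⟨H, F, hF, hA'H, hFA, hH⟩⟩ :=
    exists_large_add_or_addSubgroup hA (by omega) hδk hN a ha ha' hbox hcoord
  · exact h
  exfalso
  have hcard' : 999 / 1000 * (A.card : ℝ) ≤ A'.card := by
    refine le_trans (mul_le_mul_of_nonneg_right ?_ hApos.le) hcard
    nlinarith
  obtain ⟨x₀, hx₀⟩ : A'.Nonempty := by
    rw [← Finset.card_pos]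
    have : (0 : ℝ) < A'.card := by linarith
    exact_mod_cast this
  have hA'F : A'.card ≤ F.card := by
    refine Finset.card_le_card_of_injOn (fun x => toTorus k (x - x₀)) (fun x hx => ?_)
      fun x hx y hy hxy => ?_
    · rw [hF]
      exact hA'H x hx x₀ hx₀
    · dsimp only at hxy
      rw [map_sub, map_sub, sub_left_inj] at hxy
      exact eq_of_toTorus_eq (hbox' x hx) (hbox' y hy) hxy
  obtain ⟨i₀, i₁, hi⟩ : ∃ i₀ i₁ : Fin k, i₀ ≠ i₁ :=
    ⟨⟨0, by omega⟩, ⟨1, by omega⟩, by simp⟩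
  obtain ⟨γ, γ', hγH, hγ'H, hγ, hγ', hγγ'⟩ := exists_small_independent hi hδ hA hA'A hcard'
    hbox' hpoor hF hA'F hH
  obtain ⟨E, hE⟩ : ∃ E : Finset (ℕ × ℕ), ∀ n, n ∈ E ↔ (n.1 < 100 ∧ n.2 < 100) ∧
      ∀ x ∈ A', ¬ gridBox i₀ i₁ (fun i => a i i) n x :=
    ⟨(Finset.range 100 ×ˢ Finset.range 100).filter fun n =>
      ∀ x ∈ A', ¬ gridBox i₀ i₁ (fun i => a i i) n x, fun n => by
      rw [Finset.mem_filter, Finset.mem_product, Finset.mem_range, Finset.mem_range]⟩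
  have hmissed := card_missed_boxes_le hbox' hF hx₀ hA'H (fun u v => by
    have h := exists_mem_near hγH hγ'H hγ hγ' hγγ' u v
    norm_num at h ⊢
    exact h) (fun n hn => ((hE n).1 hn).1) fun n hn => ((hE n).1 hn).2
  refine false_of_near_corners hi (E := E) ?_ (fun i x hx y hy => hbox i x (hA'A hx) y (hA'A hy))
    (fun i j hij x hx y hy z hz w hw => hdet i j hij x (hA'A hx) y (hA'A hy) z (hA'A hz) w
      (hA'A hw)) (c := fun i => a i i) fun m n hm hn hmn => ?_
  · by_contra! hcon
    have h1 : (1021 : ℝ) ≤ E.card := by exact_mod_cast hcon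
    have h2 : (A'.card : ℝ) ≤ F.card := by exact_mod_cast hA'F
    have h3 : (0 : ℝ) < A'.card := by linarith
    nlinarith
  · by_contra! hcon
    exact hmn ((hE _).2 ⟨⟨hm, hn⟩, hcon⟩)

/-- A set with few points on every affine hyperplane has a bounded subset with large sumset. -/
theorem exists_card_add_ge_of_poor {k : ℕ} (hk : 2 ≤ k) :
    ∃ c : ℕ, ∃ δ : ℝ, 0 < δ ∧ ∀ A : Finset (Fin k → ℝ), A.Nonempty →
      (∀ φ : (Fin k → ℝ) →ₗ[ℝ] ℝ, φ ≠ 0 → ∀ t : ℝ,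
        ((A.filter fun x => φ x = t).card : ℝ) ≤ δ * A.card) →
      ∃ Y ⊆ A, Y.card ≤ c ∧ (k + 1 + 1 / 14 : ℝ) * A.card ≤ (A + Y).card := by
  have hk0 : (0 : ℝ) < k := by exact_mod_cast (by omega : 0 < k)
  obtain ⟨N, hN⟩ := exists_nat_gt ((k + 2 : ℝ) * 1000)
  refine ⟨N + 2 * k, min (1 / 10 ^ 11) (1 / (1000 * k ^ 2)), by positivity, fun A hA hpoor => ?_⟩
  set δ : ℝ := min (1 / 10 ^ 11) (1 / (1000 * k ^ 2)) with hδ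
  have hδ1 : δ ≤ 1 / 10 ^ 11 := min_le_left _ _
  have hδk : k * (k * δ) ≤ 1 / 1000 := by
    have h1 : δ ≤ 1 / (1000 * k ^ 2) := min_le_right _ _
    rw [le_div_iff₀ (by positivity)] at h1
    linarith
  have hApos : (0 : ℝ) < A.card := by exact_mod_cast hA.card_pos
  obtain ⟨L, hedge, hbox, hdet⟩ := exists_unit_box_equiv (A := A) fun φ hφ => by
    by_contra! hcon
    obtain ⟨a, ha⟩ := hA
    have h1 := hpoor φ hφ (φ a)
    rw [Finset.filter_true_of_mem fun x hx => hcon x hx a ha] at h1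
    norm_num at hδ1
    nlinarith
  have hinj : Function.Injective L := L.injective
  obtain ⟨Y, hYA, hYc, hY⟩ := exists_card_add_ge_of_normalized hk hδ1 hδk (N := N)
    (by linarith) (hA.image L) hedge hbox hdet fun φ hφ t => by
      rw [Finset.filter_image, Finset.card_image_of_injective _ hinj,
        Finset.card_image_of_injective _ hinj]
      refine hpoor (φ.comp L.toLinearMap) (fun h => hφ (LinearMap.ext fun x => ?_)) t
      simpa using LinearMap.congr_fun h (L.symm x)
  obtain ⟨Y, hYA', rfl⟩ := Finset.subset_image_iff.1 hYA
  rw [Finset.card_image_of_injective _ hinj] at hYc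
  rw [← Finset.image_add, Finset.card_image_of_injective _ hinj,
    Finset.card_image_of_injective _ hinj] at hY
  exact ⟨Y, by simpa using hYA', hYc, hY⟩

section Fibers

variable {E Q : Type*} [AddCommGroup E] [AddCommGroup Q]

theorem add_subset_filter {π : E →+ Q} {A B Y : Finset E} {s t : Q} (hBA : B ⊆ A)
    (hB : ∀ b ∈ B, π b = s) (hY : ∀ y ∈ Y, π y = t) :
    B + Y ⊆ (A + Y).filter fun x => π x = s + t := by
  intro x hx
  refine Finset.mem_filter.2 ⟨Finset.add_subset_add_right hBA hx, ?_⟩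
  obtain ⟨b, hb, y, hy, rfl⟩ := Finset.mem_add.1 hx
  rw [map_add, hB b hb, hY y hy]

theorem card_image_le_of_card_add_le {π : E →+ Q} {A : Finset E} {C δ : ℝ} {c : ℕ}
    (hδ : 0 < δ) (hc : C / δ < c) (hA : A.Nonempty)
    (hadd : ∀ Y ⊆ A, Y.card ≤ c → ((A + Y).card : ℝ) ≤ C * A.card) {t : Q}
    (ht : δ * A.card ≤ (A.filter fun a => π a = t).card) : (A.image π).card ≤ c := by
  by_contra! hcon
  obtain ⟨T', hT', hcard⟩ := Finset.exists_subset_card_eq hcon.le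
  obtain ⟨Y, hYA, hYT, hYc⟩ : ∃ Y ⊆ A, Set.InjOn π Y ∧ Y.card = c := by
    obtain ⟨Y, hYA, hinj, hYT⟩ := Finset.exists_subset_injOn_image_eq_of_surjOn (s := (A : Set E))
      (t := T') (f := π) (fun y hy => by simpa using hT' hy)
    exact ⟨Y, by exact_mod_cast hYA, hinj, by rw [← hcard, ← hYT, Finset.card_image_of_injOn hinj]⟩
  have h1 := hadd Y hYA hYc.le
  have h2 : ((A.filter fun a => π a = t) + Y).card =
      (A.filter fun a => π a = t).card * Y.card := by
    rw [Finset.card_add_iff]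
    rintro ⟨a, y⟩ h ⟨a', y'⟩ h' heq
    rw [Set.mem_prod, Finset.mem_coe, Finset.mem_coe, Finset.mem_filter] at h h'
    dsimp only at h h' heq
    have h3 := congrArg π heq
    rw [map_add, map_add, h.1.2, h'.1.2, add_right_inj] at h3
    have h4 := hYT h.2 h'.2 h3
    subst h4
    rw [add_left_inj] at heq
    rw [heq]
  have h3 : (A.filter fun a => π a = t).card * Y.card ≤ (A + Y).card :=
    h2 ▸ Finset.card_le_card (Finset.add_subset_add_right (Finset.filter_subset _ _))
  have h4 : ((A.filter fun a => π a = t).card : ℝ) * c ≤ (A + Y).card := by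
    rw [← hYc]; exact_mod_cast h3
  have hApos : (0 : ℝ) < A.card := by exact_mod_cast hA.card_pos
  rw [div_lt_iff₀ hδ] at hc
  have h5 : δ * A.card * c ≤ (A.filter fun a => π a = t).card * (c : ℝ) :=
    mul_le_mul_of_nonneg_right ht c.cast_nonneg
  nlinarith

theorem exists_fiber_function {π : E →+ Q} {A : Finset E} {w D : Q → ℝ} {c₁ c₂ N : ℕ}
    (hT : (A.image π).card ≤ N)
    (h₁ : ∀ t ∈ A.image π, ∃ Y ⊆ A, Y.card ≤ c₁ ∧
      D t ≤ ((A + Y).filter fun x => π x = t + t).card)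
    (h₂ : ∀ s ∈ A.image π, ∀ t ∈ A.image π, ∃ Y ⊆ A, Y.card ≤ c₂ ∧
      w s + w t ≤ ((A + Y).filter fun x => π x = s + t).card) :
    ∃ Y ⊆ A, Y.card ≤ N * c₁ + N * N * c₂ ∧ ∃ g : Q → ℝ, (∀ x, 0 ≤ g x) ∧
      (∀ t ∈ A.image π, D t ≤ g (t + t)) ∧
      (∀ s ∈ A.image π, ∀ t ∈ A.image π, w s + w t ≤ g (s + t)) ∧
      ∑ x ∈ A.image π + A.image π, g x ≤ (A + Y).card := by
  choose! Y₁ hY₁A hY₁c hY₁ using h₁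
  choose! Y₂ hY₂A hY₂c hY₂ using h₂
  set T := A.image π with hTdef
  set U := T.biUnion Y₁ ∪ (T ×ˢ T).biUnion fun p => Y₂ p.1 p.2 with hU
  have hUA : U ⊆ A := by
    refine Finset.union_subset (Finset.biUnion_subset.2 hY₁A) (Finset.biUnion_subset.2 ?_)
    rintro ⟨s, t⟩ hst
    rw [Finset.mem_product] at hst
    exact hY₂A s hst.1 t hst.2
  have hmono : ∀ Y ⊆ U, ∀ t, ((A + Y).filter fun x => π x = t).card ≤
      ((A + U).filter fun x => π x = t).card := fun Y hY t =>
    Finset.card_le_card (Finset.filter_subset_filter _ (Finset.add_subset_add_left hY))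
  refine ⟨U, hUA, ?_, fun t => ((A + U).filter fun x => π x = t).card,
    fun _ => Nat.cast_nonneg _, fun t ht => (hY₁ t ht).trans ?_,
    fun s hs t ht => (hY₂ s hs t ht).trans ?_, ?_⟩
  · refine (Finset.card_union_le _ _).trans (add_le_add ?_ ?_)
    · exact (Finset.card_biUnion_le_card_mul _ _ _ hY₁c).trans (Nat.mul_le_mul_right _ hT)
    · refine (Finset.card_biUnion_le_card_mul _ _ c₂ ?_).trans (Nat.mul_le_mul_right _ ?_)
      · rintro ⟨s, t⟩ hst
        rw [Finset.mem_product] at hst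
        exact hY₂c s hst.1 t hst.2
      · rw [Finset.card_product]
        exact Nat.mul_le_mul hT hT
  · exact Nat.cast_le.2 (hmono _ (Finset.subset_union_left.trans'
      (Finset.subset_biUnion_of_mem _ ht)) _)
  · exact Nat.cast_le.2 (hmono _ (Finset.subset_union_right.trans'
      (Finset.subset_biUnion_of_mem (fun p : Q × Q => Y₂ p.1 p.2)
        (Finset.mem_product.2 ⟨hs, ht⟩ : (s, t) ∈ T ×ˢ T))) _)
  · rw [← Nat.cast_sum, Nat.cast_le]
    refine (Finset.card_eq_sum_card_fiberwise (f := π) fun x hx => ?_).ge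
    obtain ⟨a, ha, u, hu, rfl⟩ := Finset.mem_add.1 (Finset.mem_coe.1 hx)
    rw [map_add]
    exact Finset.mem_coe.2 (Finset.add_mem_add (Finset.mem_image_of_mem _ ha)
      (Finset.mem_image_of_mem _ (hUA hu)))

end Fibers

/-- The size of the fibre of `π` over `t` in `A`, counted as `0` if it is less than `θ * |A|`. -/
noncomputable def bigFiberCard {E Q : Type*} (π : E → Q) (A : Finset E) (θ : ℝ) (t : Q) : ℝ :=
  if θ * A.card ≤ (A.filter fun a => π a = t).card then (A.filter fun a => π a = t).card else 0

theorem bigFiberCard_nonneg {E Q : Type*} (π : E → Q) (A : Finset E) (θ : ℝ) (t : Q) :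
    0 ≤ bigFiberCard π A θ t := by
  unfold bigFiberCard
  split_ifs
  · exact Nat.cast_nonneg _
  · exact le_rfl

theorem le_sum_bigFiberCard {E Q : Type*} (π : E → Q) (A : Finset E) {θ : ℝ} (hθ : 0 ≤ θ) :
    (1 - (A.image π).card * θ) * A.card ≤ ∑ t ∈ A.image π, bigFiberCard π A θ t := by
  have h1 : (A.card : ℝ) = ∑ t ∈ A.image π, ((A.filter fun a => π a = t).card : ℝ) := by
    rw [← Nat.cast_sum, ← Finset.card_eq_sum_card_image]
  have h2 : ∑ t ∈ A.image π, ((A.filter fun a => π a = t).card : ℝ) ≤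
      ∑ t ∈ A.image π, (bigFiberCard π A θ t + θ * A.card) := by
    refine Finset.sum_le_sum fun t _ => ?_
    have : 0 ≤ θ * A.card := mul_nonneg hθ (Nat.cast_nonneg _)
    unfold bigFiberCard
    split_ifs <;> linarith
  rw [← h1, Finset.sum_add_distrib, Finset.sum_const, nsmul_eq_mul] at h2
  linarith

theorem exists_card_fiber_add_ge {E : Type*} [AddCommGroup E] [Module ℝ E]
    {ε θ : ℝ} (hε : 0 < ε) (hε' : ε ≤ 1 / 2) (hθ : 0 < θ) :
    ∃ c : ℕ, ∀ {Q : Type*} [AddCommGroup Q] (π : E →+ Q) (A : Finset E), 1 ≤ ε * (θ * A.card) →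
      ∀ s ∈ A.image π, ∀ t ∈ A.image π, ∃ Y ⊆ A, Y.card ≤ c ∧
        (1 - 2 * ε) * bigFiberCard π A θ s + (1 - 2 * ε) * bigFiberCard π A θ t ≤
          ((A + Y).filter fun x => π x = s + t).card := by
  obtain ⟨c, hc⟩ := exists_card_add_ge (M := E) (r := 1 / θ) hε
  refine ⟨c + 1, fun π A hA s hs t ht => ?_⟩
  have hsub : ∀ t, (A.filter fun a => π a = t) ⊆ A := fun t => Finset.filter_subset _ _
  have hmem : ∀ t, ∀ a ∈ A.filter fun a => π a = t, π a = t :=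
    fun t a ha => (Finset.mem_filter.1 ha).2
  have hcast : ∀ {X Y : Finset E}, X ⊆ Y → (X.card : ℝ) ≤ Y.card :=
    fun h => Nat.cast_le.2 (Finset.card_le_card h)
  have hsingle : ∀ s, ∀ t ∈ A.image π, ∃ Y ⊆ A, Y.card ≤ c + 1 ∧
      ((A.filter fun a => π a = s).card : ℝ) ≤
        ((A + Y).filter fun x => π x = s + t).card := by
    intro s t ht
    obtain ⟨y, hy, rfl⟩ := Finset.mem_image.1 ht
    refine ⟨{y}, Finset.singleton_subset_iff.2 hy, by simp, ?_⟩
    rw [← Finset.card_add_singleton _ y]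
    exact hcast (add_subset_filter (hsub s) (hmem s) (by simp))
  have hle : ∀ s, (1 - 2 * ε) * ((A.filter fun a => π a = s).card : ℝ) ≤
      (A.filter fun a => π a = s).card := fun s => by
    nlinarith [(Nat.cast_nonneg _ : (0 : ℝ) ≤ (A.filter fun a => π a = s).card)]
  by_cases hs' : θ * A.card ≤ (A.filter fun a => π a = s).card <;>
    by_cases ht' : θ * A.card ≤ (A.filter fun a => π a = t).card <;>
    simp only [bigFiberCard, hs', ht', if_true, if_false, mul_zero, add_zero, zero_add]
  · have hApos : 0 < θ * A.card := by
      by_contra! h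
      nlinarith
    have hspos := hApos.trans_le hs'
    obtain ⟨Y, hYt, hYc, hY⟩ := hc (A.filter fun a => π a = s) (A.filter fun a => π a = t)
      (by rw [← Finset.card_pos]; exact_mod_cast hspos)
      (by
        rw [div_mul_eq_mul_div, one_mul, le_div_iff₀ hθ]
        have := hcast (hsub t)
        nlinarith)
      (by
        have : (2 : ℝ) ≤ (A.filter fun a => π a = t).card := by nlinarith
        exact_mod_cast this)
      (hA.trans (mul_le_mul_of_nonneg_left ht' hε.le))
    refine ⟨Y, hYt.trans (hsub t), by omega, le_trans ?_
      (hcast (add_subset_filter (hsub s) (hmem s) fun y hy => hmem t y (hYt hy)))⟩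
    linarith [hle s]
  · obtain ⟨Y, hYA, hYc, hY⟩ := hsingle s t ht
    exact ⟨Y, hYA, hYc, (hle s).trans hY⟩
  · obtain ⟨Y, hYA, hYc, hY⟩ := hsingle t s hs
    rw [add_comm t s] at hY
    exact ⟨Y, hYA, hYc, (hle t).trans hY⟩
  · exact ⟨∅, Finset.empty_subset _, Nat.zero_le _, Nat.cast_nonneg _⟩

section Cosets

variable {E : Type*} [AddCommGroup E] [Module ℝ E]

theorem exists_card_add_ge_of_poor_in_coset {k : ℕ} (hk : 2 ≤ k) :
    ∃ c : ℕ, ∃ δ : ℝ, 0 < δ ∧ ∀ (V : Submodule ℝ E), Module.finrank ℝ V = k → ∀ B : Finset E,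
      B.Nonempty → (∀ a ∈ B, ∀ b ∈ B, a - b ∈ V) →
      (∀ W : Submodule ℝ E, Module.finrank ℝ W = k - 1 → ∀ x,
        ((B.filter fun a => a - x ∈ W).card : ℝ) ≤ δ * B.card) →
      ∃ Y ⊆ B, Y.card ≤ c ∧ (k + 1 + 1 / 14 : ℝ) * B.card ≤ (B + Y).card := by
  obtain ⟨c, δ, hδ, H⟩ := exists_card_add_ge_of_poor hk
  refine ⟨c, δ, hδ, fun V hV B hB hBV hpoor => ?_⟩
  have : FiniteDimensional ℝ V := Module.finite_of_finrank_pos (by omega)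
  let e : V ≃ₗ[ℝ] (Fin k → ℝ) := LinearEquiv.ofFinrankEq _ _ (by simp [hV])
  obtain ⟨p, hp⟩ := V.subtype.exists_leftInverse_of_injective V.ker_subtype
  have hpv : ∀ v : V, p v = v := fun v => LinearMap.congr_fun hp v
  set f : E →ₗ[ℝ] (Fin k → ℝ) := e.toLinearMap ∘ₗ p with hf
  have hfv : ∀ v : V, f v = e v := fun v => by simp [hf, hpv]
  have hinj : Set.InjOn f B := by
    intro a ha b hb hab
    have h1 : f ((⟨a - b, hBV a ha b hb⟩ : V) : E) = 0 := by
      rw [map_sub, hab, sub_self]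
    rw [hfv, map_eq_zero_iff e e.injective, Submodule.mk_eq_zero] at h1
    exact sub_eq_zero.1 h1
  obtain ⟨Y, hYB, hYc, hY⟩ := H (B.image f) (hB.image f) fun φ hφ t => by
    rw [Finset.filter_image, Finset.card_image_of_injOn hinj]
    refine (Nat.cast_le.2 Finset.card_image_le).trans ?_
    rcases (B.filter fun x => φ (f x) = t).eq_empty_or_nonempty with h | ⟨x, hx⟩
    · rw [h]
      simpa using mul_nonneg hδ.le (Nat.cast_nonneg B.card)
    set ψ : V →ₗ[ℝ] ℝ := φ ∘ₗ e.toLinearMap with hψ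
    have hψ0 : ψ ≠ 0 := fun h => hφ (LinearMap.ext fun x => by
      simpa [hψ] using LinearMap.congr_fun h (e.symm x))
    refine le_trans (Nat.cast_le.2 (Finset.card_le_card fun y hy => ?_))
      (hpoor ((LinearMap.ker ψ).map V.subtype) ?_ x)
    · rw [Finset.mem_filter] at hx hy
      refine Finset.mem_filter.2 ⟨hy.1, ⟨⟨y - x, hBV y hy.1 x hx.1⟩, ?_, rfl⟩⟩
      change φ (e _) = 0
      rw [← hfv, map_sub, map_sub, hy.2, hx.2, sub_self]
    · rw [Submodule.finrank_map_subtype_eq]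
      have := Module.Dual.finrank_ker_add_one_of_ne_zero (f := ψ) hψ0
      omega
  obtain ⟨Y, hYB', rfl⟩ := Finset.subset_image_iff.1 hYB
  have hYB'' : Y ⊆ B := by exact_mod_cast hYB'
  rw [Finset.card_image_of_injOn (hinj.mono hYB')] at hYc
  rw [← Finset.image_add, Finset.card_image_of_injOn hinj] at hY
  exact ⟨Y, hYB'', hYc, hY.trans (Nat.cast_le.2 Finset.card_image_le)⟩

theorem affineRank_image_add {Q : Type*} [AddCommGroup Q] [Module ℝ Q] [FiniteDimensional ℝ E]
    {A : Finset E} (hA : vectorSpan ℝ (A : Set E) = ⊤) {π : E →ₗ[ℝ] Q}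
    (hπ : Function.Surjective π) :
    affineRank (A.image π) + Module.finrank ℝ (LinearMap.ker π) = Module.finrank ℝ E := by
  have h : vectorSpan ℝ ((A.image π : Finset Q) : Set Q) = ⊤ := by
    have h1 := π.toAffineMap.map_vectorSpan (s := (A : Set E))
    rw [hA] at h1
    rw [Finset.coe_image]
    exact h1.symm.trans (by rw [LinearMap.toAffineMap_linear, Submodule.map_top,
      LinearMap.range_eq_top.2 hπ])
  rw [affineRank, h, finrank_top, ← LinearMap.finrank_range_add_finrank_ker π,
    LinearMap.range_eq_top.2 hπ, finrank_top]

theorem exists_cover_of_card_image_le {Q : Type*} [AddCommGroup Q] [Module ℝ Q] {A : Finset E}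
    {π : E →ₗ[ℝ] Q} {N : ℕ} (h : (A.image π).card ≤ N) :
    ∃ T : Finset E, T.card ≤ N ∧ (A : Set E) ⊆ ⋃ t ∈ T, (t +ᵥ (LinearMap.ker π : Set E)) := by
  have hr : ∀ q ∈ A.image π, ∃ x, π x = q := fun q hq =>
    let ⟨a, _, ha⟩ := Finset.mem_image.1 hq
    ⟨a, ha⟩
  choose! r hr using hr
  refine ⟨(A.image π).image r, Finset.card_image_le.trans h, fun a ha => ?_⟩
  have hπa := Finset.mem_image_of_mem π (Finset.mem_coe.1 ha)
  refine Set.mem_iUnion₂.2 ⟨r (π a), Finset.mem_image_of_mem _ hπa, ?_⟩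
  rw [Set.mem_vadd_set]
  exact ⟨a - r (π a), by simp [hr _ hπa], by simp⟩

/-- If `A` has small sumsets with its bounded subsets and few points in cosets of
`(k - 1)`-dimensional subspaces, then it has few points in cosets of `k`-dimensional ones. -/
theorem exists_card_fiber_le [FiniteDimensional ℝ E] {d k : ℕ} (hd : Module.finrank ℝ E = d)
    (hk : 1 ≤ k) {δ : ℝ} (hδ : 0 < δ) :
    ∃ c : ℕ, ∃ δ' K : ℝ, 0 < δ' ∧ ∀ A : Finset E, A.Nonempty → vectorSpan ℝ (A : Set E) = ⊤ →
      (∀ Y ⊆ A, Y.card ≤ c → ((A + Y).card : ℝ) ≤ (d + 1 + 1 / 16) * A.card) →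
      (¬ ∃ l : Submodule ℝ E, Module.finrank ℝ l = 1 ∧ ∃ T : Finset E, T.card ≤ (d + 1) ^ 2 ∧
        (A : Set E) ⊆ ⋃ t ∈ T, (t +ᵥ (l : Set E))) →
      K ≤ A.card →
      (∀ W : Submodule ℝ E, Module.finrank ℝ W = k - 1 → ∀ x,
        ((A.filter fun a => a - x ∈ W).card : ℝ) ≤ δ' * A.card) →
      ∀ {Q : Type*} [AddCommGroup Q] [Module ℝ Q] (π : E →ₗ[ℝ] Q), Function.Surjective π →
        Module.finrank ℝ (LinearMap.ker π) = k →
        ∀ t, ((A.filter fun a => π a = t).card : ℝ) ≤ δ * A.card := by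
  obtain ⟨N, hN⟩ := exists_nat_gt ((d + 1 + 1 / 16 : ℝ) / δ)
  have hN0 : (0 : ℝ) < N := lt_trans (by positivity) hN
  obtain ⟨η, hη⟩ : ∃ η : ℝ, η = 1 / (1000 * (d + 2)) := ⟨_, rfl⟩
  have hη0 : 0 < η := by rw [hη]; positivity
  have hηd : η * (d + 2) = 1 / 1000 := by rw [hη]; field_simp
  have hη' : η ≤ 1 / 2 := by nlinarith [(Nat.cast_nonneg d : (0 : ℝ) ≤ d)]
  have hθ : 0 < η / N := by positivity
  obtain ⟨c₂, h₂⟩ := exists_card_fiber_add_ge (E := E) hη0 hη' hθ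
  obtain ⟨c₁, δ', hδ', h₁⟩ : ∃ c : ℕ, ∃ δ : ℝ, 0 < δ ∧ (2 ≤ k → ∀ (V : Submodule ℝ E),
      Module.finrank ℝ V = k → ∀ B : Finset E, B.Nonempty → (∀ a ∈ B, ∀ b ∈ B, a - b ∈ V) →
      (∀ W : Submodule ℝ E, Module.finrank ℝ W = k - 1 → ∀ x,
        ((B.filter fun a => a - x ∈ W).card : ℝ) ≤ δ * B.card) →
      ∃ Y ⊆ B, Y.card ≤ c ∧ (k + 1 + 1 / 14 : ℝ) * B.card ≤ (B + Y).card) := by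
    by_cases h : 2 ≤ k
    · obtain ⟨c, δ, hδ, H⟩ := exists_card_add_ge_of_poor_in_coset (E := E) h
      exact ⟨c, δ, hδ, fun _ => H⟩
    · exact ⟨0, 1, one_pos, fun h' => absurd h' h⟩
  refine ⟨N + (N * c₁ + N * N * c₂), δ' * (η / N), 1 / (η * (η / N)), by positivity, ?_⟩
  intro A hA hspan hadd hcover hK hpoor Q _ _ π hπ hker t₀
  by_contra! hcon
  have : FiniteDimensional ℝ Q := Module.Finite.of_surjective π hπ
  have hApos : (0 : ℝ) < A.card := by exact_mod_cast hA.card_pos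
  rw [div_le_iff₀ (by positivity)] at hK
  have hT : (A.image π).card ≤ N := card_image_le_of_card_add_le (π := π.toAddMonoidHom) hδ hN hA
    (fun Y hY hYc => hadd Y hY (by omega)) hcon.le
  set b : Q → ℝ := bigFiberCard π A (η / N) with hb
  have hb0 : ∀ t, 0 ≤ b t := bigFiberCard_nonneg π A (η / N)
  obtain ⟨Y, hYA, hYc, g, hg, hgD, hgw, hgsum⟩ := exists_fiber_function (π := π.toAddMonoidHom)
    (w := fun t => (1 - 2 * η) * b t) (D := fun t => if 2 ≤ k then (k + 1 + 1 / 14) * b t else 0)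
    (c₁ := c₁) hT (fun t _ => by
      have hempty : ∃ Y ⊆ A, Y.card ≤ c₁ ∧
          (0 : ℝ) ≤ ((A + Y).filter fun x => π.toAddMonoidHom x = t + t).card :=
        ⟨∅, Finset.empty_subset _, Nat.zero_le _, Nat.cast_nonneg _⟩
      by_cases hk2 : 2 ≤ k
      swap
      · simpa only [hk2, if_false] using hempty
      by_cases hbig : η / N * A.card ≤ (A.filter fun a => π a = t).card
      swap
      · simpa only [hk2, if_true, hb, bigFiberCard, hbig, if_false, mul_zero] using hempty
      simp only [hk2, if_true, hb, bigFiberCard, hbig]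
      have hmem : ∀ a ∈ A.filter fun a => π a = t, π a = t :=
        fun a ha => (Finset.mem_filter.1 ha).2
      obtain ⟨Y, hYB, hYc, hY⟩ := h₁ hk2 _ hker (A.filter fun a => π a = t)
        (by
          rw [← Finset.card_pos]
          exact_mod_cast (mul_pos hθ hApos).trans_le hbig)
        (fun a ha b hb => by rw [LinearMap.mem_ker, map_sub, hmem a ha, hmem b hb, sub_self])
        (fun W hW x => by
          refine (Nat.cast_le.2 (Finset.card_le_card
            (Finset.filter_subset_filter _ (Finset.filter_subset _ A)))).trans
            ((hpoor W hW x).trans ?_)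
          rw [mul_assoc]
          exact mul_le_mul_of_nonneg_left hbig hδ'.le)
      exact ⟨Y, hYB.trans (Finset.filter_subset _ _), hYc, hY.trans (Nat.cast_le.2
        (Finset.card_le_card (add_subset_filter (π := π.toAddMonoidHom)
          (Finset.filter_subset _ _) hmem fun y hy => hmem y (hYB hy))))⟩)
    (h₂ π.toAddMonoidHom A (by linarith))
  have hsum : (1 - η) * A.card ≤ ∑ t ∈ A.image π, b t := by
    refine le_trans (mul_le_mul_of_nonneg_right ?_ hApos.le) (le_sum_bigFiberCard π A hθ.le)
    have h1 : ((A.image π).card : ℝ) * (η / N) ≤ N * (η / N) :=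
      mul_le_mul_of_nonneg_right (Nat.cast_le.2 hT) hθ.le
    rw [mul_div_cancel₀ _ hN0.ne'] at h1
    linarith
  set S := ∑ t ∈ A.image π, b t with hS
  have hSw : ∑ t ∈ A.image π, (1 - 2 * η) * b t = (1 - 2 * η) * S := by rw [hS, Finset.mul_sum]
  have hw : ∀ t ∈ A.image π, 0 ≤ (1 - 2 * η) * b t := fun t _ =>
    mul_nonneg (by linarith) (hb0 t)
  have hle := hadd Y hYA (by omega)
  have hrank := affineRank_image_add hspan hπ
  rw [hker, hd] at hrank
  have hrank' : (affineRank (A.image π) : ℝ) + k = d := by exact_mod_cast hrank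
  have hk' : (1 : ℝ) ≤ k := by exact_mod_cast hk
  have hd0 : (0 : ℝ) ≤ d := d.cast_nonneg
  have hS0 : 0 ≤ S := Finset.sum_nonneg fun t _ => hb0 t
  have key : ∀ ξ : ℝ, 1 / 14 ≤ ξ → ξ ≤ 1 →
      (d + 1 + ξ - 2 / 1000) * S ≤ (d + 1 + 1 / 16) * A.card → False := by
    intro ξ hξ hξ' h
    have h1 : (d + 1 + ξ - 2 / 1000) * ((1 - η) * A.card) ≤ (d + 1 + ξ - 2 / 1000) * S :=
      mul_le_mul_of_nonneg_left hsum (by linarith)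
    have h2 : (d + 1 + 1 / 16 : ℝ) < (d + 1 + ξ - 2 / 1000) * (1 - η) := by nlinarith
    nlinarith [mul_lt_mul_of_pos_right h2 hApos]
  by_cases hk2 : 2 ≤ k
  · have h := sum_diag_add_rank_mul_le hw hg hgD hgw
    simp only [hk2, if_true] at h
    rw [← Finset.mul_sum, ← hS, hSw] at h
    have h3 : (k + 1 + 1 / 14 : ℝ) * S + affineRank (A.image π) * ((1 - 2 * η) * S) ≤
        (d + 1 + 1 / 16) * A.card := h.trans (hgsum.trans hle)
    have h4 : (d + 1 + 1 / 14 - 2 / 1000 : ℝ) * S ≤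
        (k + 1 + 1 / 14) * S + affineRank (A.image π) * ((1 - 2 * η) * S) := by
      have hr : (affineRank (A.image π) : ℝ) = d - k := by linarith
      rw [hr]
      nlinarith [mul_nonneg hη0.le hS0, mul_nonneg (mul_nonneg hη0.le hS0) (by linarith : 0 ≤ (k : ℝ))]
    exact key (1 / 14) (by norm_num) (by norm_num) (h4.trans h3)
  · have hk1 : k = 1 := by omega
    subst hk1
    have hcard : (affineRank (A.image π) + 2) ^ 2 < (A.image π).card := by
      by_contra! hcon'
      have hd1 : affineRank (A.image π) + 2 = d + 1 := by omega
      rw [hd1] at hcon'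
      exact hcover ⟨_, hker, exists_cover_of_card_image_le hcon'⟩
    have h := rank_add_two_mul_le hcard hw hg hgw
    rw [hSw] at h
    have h3 : (affineRank (A.image π) + 2 + 1 / 12 : ℝ) * ((1 - 2 * η) * S) ≤
        (d + 1 + 1 / 16) * A.card := h.trans (hgsum.trans hle)
    have hr : (affineRank (A.image π) : ℝ) = d - 1 := by
      push_cast at hrank'
      linarith
    refine key (1 / 12) (by norm_num) (by norm_num) (le_trans ?_ h3)
    rw [hr]
    nlinarith [mul_nonneg hη0.le hS0]

end Cosets

theorem exists_card_coset_le {E : Type*} [AddCommGroup E] [Module ℝ E] [FiniteDimensional ℝ E]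
    {d : ℕ} (hd : Module.finrank ℝ E = d) (k : ℕ) {δ : ℝ} (hδ : 0 < δ) :
    ∃ c : ℕ, ∃ K : ℝ, ∀ A : Finset E, A.Nonempty → vectorSpan ℝ (A : Set E) = ⊤ →
      (∀ Y ⊆ A, Y.card ≤ c → ((A + Y).card : ℝ) ≤ (d + 1 + 1 / 16) * A.card) →
      (¬ ∃ l : Submodule ℝ E, Module.finrank ℝ l = 1 ∧ ∃ T : Finset E, T.card ≤ (d + 1) ^ 2 ∧
        (A : Set E) ⊆ ⋃ t ∈ T, (t +ᵥ (l : Set E))) →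
      K ≤ A.card →
      ∀ W : Submodule ℝ E, Module.finrank ℝ W = k → ∀ x,
        ((A.filter fun a => a - x ∈ W).card : ℝ) ≤ δ * A.card := by
  induction k generalizing δ with
  | zero =>
    refine ⟨0, 1 / δ, fun A _ _ _ _ hK W hW x => ?_⟩
    rw [Submodule.finrank_eq_zero] at hW
    subst hW
    have h : (A.filter fun a => a - x ∈ (⊥ : Submodule ℝ E)).card ≤ 1 :=
      Finset.card_le_one.2 fun a ha b hb => by
        rw [Finset.mem_filter, Submodule.mem_bot, sub_eq_zero] at ha hb
        rw [ha.2, hb.2]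
    rw [div_le_iff₀ hδ] at hK
    have h' : ((A.filter fun a => a - x ∈ (⊥ : Submodule ℝ E)).card : ℝ) ≤ 1 := by
      exact_mod_cast h
    linarith
  | succ k ih =>
    obtain ⟨c, δ', K, hδ', h⟩ := exists_card_fiber_le hd (Nat.le_add_left 1 k) hδ
    obtain ⟨c', K', h'⟩ := ih hδ'
    refine ⟨c + c', max K K', fun A hA hspan hadd hcover hK W hW x => ?_⟩
    have h1 := h A hA hspan (fun Y hY hYc => hadd Y hY (by omega)) hcover
      ((le_max_left _ _).trans hK) (h' A hA hspan (fun Y hY hYc => hadd Y hY (by omega)) hcover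
        ((le_max_right _ _).trans hK)) W.mkQ W.mkQ_surjective (by rw [Submodule.ker_mkQ, hW])
      (W.mkQ x)
    refine le_trans (Nat.cast_le.2 (Finset.card_le_card fun a ha => ?_)) h1
    rw [Finset.mem_filter] at ha ⊢
    exact ⟨ha.1, (Submodule.Quotient.eq W).2 ha.2⟩

theorem exists_fin_image_eq {α : Type*} [DecidableEq α] {Y : Finset α} {n : ℕ} (hY : Y.Nonempty)
    (hn : Y.card ≤ n) : ∃ a : Fin n → α, (∀ i, a i ∈ Y) ∧ Finset.univ.image a = Y := by
  obtain ⟨f⟩ := Function.Embedding.nonempty_of_card_le (α := Y) (β := Fin n) (by simpa using hn)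
  have : Nonempty Y := hY.to_subtype
  refine ⟨fun i => (Function.invFun f i : Y).1, fun i => (Function.invFun f i).2, ?_⟩
  refine Finset.Subset.antisymm (Finset.image_subset_iff.2 fun i _ => (Function.invFun f i).2)
    fun y hy => ?_
  obtain ⟨i, hi⟩ := Function.invFun_surjective f.injective ⟨y, hy⟩
  exact Finset.mem_image.2 ⟨i, Finset.mem_univ _, by rw [hi]⟩

theorem stmt_3 (d : ℕ) :
    ∃ c : ℕ, 0 < c ∧ ∃ K : ℝ, ∀ A : Finset (Fin d → ℝ), A.Nonempty →
      Module.finrank ℝ (affineSpan ℝ (A : Set (Fin d → ℝ))).direction = d →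
      (∀ a : Fin c → (Fin d → ℝ), (∀ i, a i ∈ A) →
        ((A + Finset.image a Finset.univ).card : ℝ) ≤ (d + 1 + 1 / 16) * A.card) →
      (A.card : ℝ) ≤ K ∨
        ∃ l : Submodule ℝ (Fin d → ℝ), Module.finrank ℝ l = 1 ∧
          ∃ T : Finset (Fin d → ℝ), T.card ≤ (d + 1) ^ 2 ∧
            (A : Set (Fin d → ℝ)) ⊆ ⋃ t ∈ T, (t +ᵥ (l : Set (Fin d → ℝ))) := by
  have hd : Module.finrank ℝ (Fin d → ℝ) = d := by simp
  obtain ⟨c, K, h⟩ := exists_card_coset_le hd d (δ := 1 / 2) (by norm_num)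
  refine ⟨c + 1, by omega, K, fun A hA hspan hadd => ?_⟩
  by_contra! hcon
  have hcover : ¬ ∃ l : Submodule ℝ (Fin d → ℝ), Module.finrank ℝ l = 1 ∧
      ∃ T : Finset (Fin d → ℝ), T.card ≤ (d + 1) ^ 2 ∧
        (A : Set (Fin d → ℝ)) ⊆ ⋃ t ∈ T, (t +ᵥ (l : Set (Fin d → ℝ))) := by
    rintro ⟨l, hl, T, hT, hAT⟩
    exact hcon.2 l hl T hT hAT
  have htop : vectorSpan ℝ (A : Set (Fin d → ℝ)) = ⊤ := by
    rw [direction_affineSpan] at hspan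
    exact Submodule.eq_top_of_finrank_eq (hspan.trans hd.symm)
  have h1 := h A hA htop (fun Y hYA hYc => ?_) hcover hcon.1.le ⊤ (by rw [finrank_top, hd]) 0
  · have hApos : (0 : ℝ) < A.card := by exact_mod_cast hA.card_pos
    simp only [Submodule.mem_top, Finset.filter_true] at h1
    linarith
  · rcases Y.eq_empty_or_nonempty with rfl | hY
    · refine le_trans (b := 0) (by simp) (by positivity)
    · obtain ⟨a, haY, rfl⟩ := exists_fin_image_eq hY (hYc.trans (Nat.le_succ c))
      convert hadd a fun i => hYA (haY i)
      rfl
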